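/- arXiv:0801.3181 — 12 statements merged into one kernel-verified Lean document; each statement's English description precedes it below -/
import Mathlib

section
/- If S ⊆ ℝ is a Sierpiński set and L ⊆ ℝ is a Lusin set, then the product space S × L (with the subspace topology from ℝ × ℝ) has the Menger property. -/
/-- A topological space has the Menger property if for every sequence of open
covers one can choose finite subfamilies whose union covers the space. -/
def MengerProp (X : Type*) [TopologicalSpace X] : Prop :=
  ∀ U : ℕ → Set (Set X),
    (∀ n, (∀ u ∈ U n, IsOpen u) ∧ ⋃₀ U n = Set.univ) →
    ∃ V : ℕ → Set (Set X),
      (∀ n, V n ⊆ U n ∧ (V n).Finite) ∧ (⋃ n, ⋃₀ V n) = Set.univ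

/-- A Sierpiński set: an uncountable set of reals meeting every Lebesgue
measure-zero set in a countable set. -/
def IsSierpinskiSet (S : Set ℝ) : Prop :=
  ¬ S.Countable ∧
    ∀ N : Set ℝ, MeasureTheory.volume N = 0 → (S ∩ N).Countable

/-- A Lusin set: an uncountable set of reals meeting every meager set in a
countable set. -/
def IsLusinSet (L : Set ℝ) : Prop :=
  ¬ L.Countable ∧ ∀ M : Set ℝ, IsMeagre M → (L ∩ M).Countable

open MeasureTheory Set

/-- Relative Menger property for subsets of the plane. -/
def MengerOn (A : Set (ℝ × ℝ)) : Prop :=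
  ∀ U : ℕ → Set (Set (ℝ × ℝ)), (∀ n, (∀ u ∈ U n, IsOpen u) ∧ A ⊆ ⋃₀ U n) →
    ∃ V : ℕ → Set (Set (ℝ × ℝ)), (∀ n, V n ⊆ U n ∧ (V n).Finite) ∧ A ⊆ ⋃ n, ⋃₀ V n

lemma mengerOn_iUnion (A : ℕ → Set (ℝ × ℝ)) (h : ∀ k, MengerOn (A k)) :
    MengerOn (⋃ k, A k) := by
  intro U hU
  have h1 : ∀ k, ∃ V : ℕ → Set (Set (ℝ × ℝ)),
      (∀ n, V n ⊆ U (Nat.pair k n) ∧ (V n).Finite) ∧ A k ⊆ ⋃ n, ⋃₀ V n := fun k =>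
    h k (fun n => U (Nat.pair k n)) fun n =>
      ⟨(hU _).1, (subset_iUnion A k).trans (hU _).2⟩
  choose V hV hA using h1
  refine ⟨fun n => V n.unpair.1 n.unpair.2, fun n => ?_, ?_⟩
  · have := hV n.unpair.1 n.unpair.2
    rwa [Nat.pair_unpair] at this
  · refine iUnion_subset fun k x hx => ?_
    obtain ⟨n, hn⟩ := mem_iUnion.1 (hA k hx)
    refine mem_iUnion.2 ⟨Nat.pair k n, ?_⟩
    simpa using hn

lemma mengerOn_empty : MengerOn ∅ := fun _ _ => ⟨fun _ => ∅, by simp, by simp⟩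

lemma mengerOn_singleton (p : ℝ × ℝ) : MengerOn {p} := by
  intro U hU
  have : ∀ n, ∃ u ∈ U n, p ∈ u := fun n => by
    simpa using (hU n).2 (mem_singleton p)
  choose u hu hp using this
  refine ⟨fun n => {u n}, fun n => ⟨by simpa using hu n, finite_singleton _⟩, ?_⟩
  rintro x rfl
  exact mem_iUnion.2 ⟨0, by simpa using hp 0⟩

lemma mengerOn_biUnion {ι : Type*} {C : Set ι} (hC : C.Countable) (A : ι → Set (ℝ × ℝ))
    (h : ∀ c ∈ C, MengerOn (A c)) : MengerOn (⋃ c ∈ C, A c) := by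
  rcases C.eq_empty_or_nonempty with rfl | hne
  · simpa using mengerOn_empty
  · obtain ⟨f, rfl⟩ := hC.exists_eq_range hne
    rw [biUnion_range]
    exact mengerOn_iUnion _ fun k => h _ ⟨k, rfl⟩

lemma mengerOn_countable {A : Set (ℝ × ℝ)} (hA : A.Countable) : MengerOn A := by
  have := mengerOn_biUnion hA (fun p => {p}) fun c _ => mengerOn_singleton c
  simpa using this

lemma box_lemma (μ : Measure ℝ) [IsFiniteMeasure μ] (S : Set ℝ) (d : ℝ)
    (U : Set (Set (ℝ × ℝ))) (hU : ∀ u ∈ U, IsOpen u) (hc : ∀ s ∈ S, (s, d) ∈ ⋃₀ U)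
    (ε : ENNReal) (hε : ε ≠ 0) :
    ∃ (F : Set (Set (ℝ × ℝ))) (I J : Set ℝ), F ⊆ U ∧ F.Finite ∧ IsOpen J ∧ d ∈ J ∧
      μ (S \ I) ≤ ε ∧ ∀ s ∈ I, ∀ y ∈ J, (s, y) ∈ ⋃₀ F := by
  have : ∀ s : S, ∃ (u : Set (ℝ × ℝ)) (A B : Set ℝ), u ∈ U ∧ IsOpen A ∧ IsOpen B ∧ s.1 ∈ A ∧
      d ∈ B ∧ A ×ˢ B ⊆ u := by
    intro s
    obtain ⟨u, hu, hs⟩ := hc s s.2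
    obtain ⟨A, B, h1, h2, h3, h4, h5⟩ := isOpen_prod_iff.1 (hU u hu) s d hs
    exact ⟨u, A, B, hu, h1, h2, h3, h4, h5⟩
  choose u A B hu hA hB hsA hdB hsub using this
  have hO : IsOpen (⋃ s, A s) := isOpen_iUnion hA
  obtain ⟨K, hKO, hK, hμ⟩ := hO.measurableSet.exists_isCompact_sdiff_lt (measure_ne_top μ _) hε
  obtain ⟨t, ht⟩ := hK.elim_finite_subcover A hA hKO
  refine ⟨u '' t, K, ⋂ s ∈ t, B s, ?_, t.finite_toSet.image u,
    isOpen_biInter_finset fun s _ => hB s, by simpa using fun a b _ => hdB ⟨a, b⟩, ?_, ?_⟩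
  · rintro _ ⟨s, _, rfl⟩
    exact hu s
  · refine (measure_mono ?_).trans hμ.le
    exact sdiff_subset_sdiff_left fun s hs => mem_iUnion.2 ⟨⟨s, hs⟩, hsA ⟨s, hs⟩⟩
  · intro s hs y hy
    obtain ⟨i, hi, hsi⟩ := mem_iUnion₂.1 (ht hs)
    exact ⟨u i, ⟨i, hi, rfl⟩, hsub i ⟨hsi, mem_iInter₂.1 hy i hi⟩⟩

lemma main_lemma (μ : Measure ℝ) [IsFiniteMeasure μ] (S : Set ℝ) (d : ℕ → ℝ)
    (U : ℕ → Set (Set (ℝ × ℝ))) (hU : ∀ n, ∀ u ∈ U n, IsOpen u)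
    (hc : ∀ n k, ∀ s ∈ S, (s, d k) ∈ ⋃₀ U n) :
    ∃ (V : ℕ → Set (Set (ℝ × ℝ))) (N : Set ℝ) (O : ℕ → Set ℝ),
      (∀ n, V n ⊆ U n ∧ (V n).Finite) ∧ μ N = 0 ∧ (∀ m, IsOpen (O m)) ∧
      (∀ m k, d k ∈ O m) ∧
      ∀ s ∈ S, s ∉ N → ∀ y, (∀ m, y ∈ O m) → (s, y) ∈ ⋃ n, ⋃₀ V n := by
  obtain ⟨ε, hε, hsum⟩ := ENNReal.exists_pos_sum_of_countable (one_ne_zero) (ℕ × ℕ)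
  have h := fun n k => box_lemma μ S (d k) (U n) (hU n) (hc n k) (ε (n, k))
    (by exact_mod_cast (hε (n, k)).ne')
  choose F I J hFU hF hJ hd hμ hcov using h
  have hfin : ∀ᵐ x ∂μ, {i : ℕ × ℕ | x ∈ S \ I i.1 i.2}.Finite := by
    refine ae_finite_setOfPred_mem (s := fun i : ℕ × ℕ => S \ I i.1 i.2) ?_
    exact ((ENNReal.tsum_le_tsum fun i : ℕ × ℕ => hμ i.1 i.2).trans_lt
      (hsum.trans ENNReal.one_lt_top)).ne
  refine ⟨fun n => ⋃ k ∈ Iic n, F n k, {x | ¬ {i : ℕ × ℕ | x ∈ S \ I i.1 i.2}.Finite},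
    fun m => ⋃ n ∈ Ici m, ⋃ k ∈ Iic n, J n k, fun n => ⟨?_, ?_⟩, ae_iff.1 hfin, ?_, ?_, ?_⟩
  · exact iUnion₂_subset fun k _ => hFU n k
  · exact (finite_Iic n).biUnion fun k _ => hF n k
  · exact fun m => isOpen_biUnion fun n _ => isOpen_biUnion fun k _ => hJ n k
  · intro m k
    exact mem_iUnion₂.2 ⟨max m k, le_max_left m k,
      mem_iUnion₂.2 ⟨k, mem_Iic.2 (le_max_right m k), hd _ _⟩⟩
  · intro s hs hN y hy
    have hN' : {i : ℕ × ℕ | s ∈ S \ I i.1 i.2}.Finite := not_not.1 hN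
    obtain ⟨m, hm⟩ := (hN'.image Prod.fst).bddAbove
    obtain ⟨n, hn, h2⟩ := mem_iUnion₂.1 (hy (m + 1))
    obtain ⟨k, hk, hyk⟩ := mem_iUnion₂.1 h2
    have hsI : s ∈ I n k := by
      by_contra hcon
      have : n ≤ m := hm ⟨(n, k), ⟨hs, hcon⟩, rfl⟩
      have : m + 1 ≤ n := hn
      omega
    obtain ⟨u, hu, hmem⟩ := hcov n k s hsI y hyk
    exact mem_iUnion.2 ⟨n, u, mem_iUnion₂.2 ⟨k, hk, hu⟩, hmem⟩

lemma lusin_diff {L : Set ℝ} (hL : ∀ M : Set ℝ, IsMeagre M → (L ∩ M).Countable)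
    (d : ℕ → ℝ) (hd : L ⊆ closure (range d)) (O : ℕ → Set ℝ) (hO : ∀ m, IsOpen (O m))
    (hdO : ∀ m k, d k ∈ O m) : (L \ ⋂ m, O m).Countable := by
  have hM : IsMeagre (⋃ m, closure (range d) \ O m) := by
    refine isMeagre_iUnion fun m => IsNowhereDense.isMeagre ?_
    rw [(isClosed_closure.sdiff (hO m)).isNowhereDense_iff]
    by_contra hne
    obtain ⟨x, hx⟩ := nonempty_iff_ne_empty.2 hne
    have hxc : x ∈ closure (range d) := (interior_subset hx).1
    obtain ⟨_, h1, k, rfl⟩ := mem_closure_iff.1 hxc _ isOpen_interior hx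
    exact (interior_subset h1).2 (hdO m k)
  refine (hL _ hM).mono ?_
  rintro y ⟨hy, hyO⟩
  rw [mem_iInter, not_forall] at hyO
  obtain ⟨m, hm⟩ := hyO
  exact ⟨hy, mem_iUnion.2 ⟨m, hd hy, hm⟩⟩

lemma exists_dense (L : Set ℝ) (hne : L.Nonempty) :
    ∃ d : ℕ → ℝ, (∀ k, d k ∈ L) ∧ L ⊆ closure (range d) := by
  obtain ⟨c, hcL, hc, hcl⟩ :=
    (TopologicalSpace.IsSeparable.of_separableSpace L).exists_countable_dense_subset
  have hcne : c.Nonempty := by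
    obtain ⟨x, hx⟩ := hne
    exact closure_nonempty_iff.1 ⟨x, hcl hx⟩
  obtain ⟨d, rfl⟩ := hc.exists_eq_range hcne
  exact ⟨d, fun k => hcL ⟨k, rfl⟩, hcl⟩

lemma cov_union {U V W : ℕ → Set (Set (ℝ × ℝ))} (hV : ∀ n, V n ⊆ U n ∧ (V n).Finite)
    (hW : ∀ n, W n ⊆ U n ∧ (W n).Finite) :
    ∃ X : ℕ → Set (Set (ℝ × ℝ)), (∀ n, X n ⊆ U n ∧ (X n).Finite) ∧
      (⋃ n, ⋃₀ V n) ⊆ (⋃ n, ⋃₀ X n) ∧ (⋃ n, ⋃₀ W n) ⊆ (⋃ n, ⋃₀ X n) :=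
  ⟨fun n => V n ∪ W n, fun n => ⟨union_subset (hV n).1 (hW n).1, (hV n).2.union (hW n).2⟩,
    iUnion_mono fun _ => sUnion_subset_sUnion subset_union_left,
    iUnion_mono fun _ => sUnion_subset_sUnion subset_union_right⟩

lemma mengerOn_vertical {L : Set ℝ} (hL : ∀ M : Set ℝ, IsMeagre M → (L ∩ M).Countable)
    (hne : L.Nonempty) (c : ℝ) : MengerOn ({c} ×ˢ L) := by
  intro U hU
  obtain ⟨d, hdL, hd⟩ := exists_dense L hne
  obtain ⟨V, N, O, hV, hN, hO, hdO, hcov⟩ := main_lemma (Measure.dirac c) {c} d U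
    (fun n => (hU n).1) (fun n k s hs => (hU n).2 ⟨hs, hdL k⟩)
  have hcN : c ∉ N := by
    intro h
    simp [Measure.dirac_apply_of_mem h] at hN
  have hcount := lusin_diff hL d hd O hO hdO
  obtain ⟨W, hW, hWc⟩ := mengerOn_countable ((countable_singleton c).prod hcount) U
    fun n => ⟨(hU n).1, (prod_mono_right sdiff_subset).trans (hU n).2⟩
  obtain ⟨X, hX, h1, h2⟩ := cov_union hV hW
  refine ⟨X, hX, ?_⟩
  rintro ⟨s, y⟩ ⟨hs, hy⟩
  obtain rfl : s = c := hs
  by_cases hyO : y ∈ ⋂ m, O m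
  · exact h1 (hcov s rfl hcN y (mem_iInter.1 hyO))
  · exact h2 (hWc ⟨rfl, hy, hyO⟩)

lemma mengerOn_prod {S L : Set ℝ} (hS : ∀ N : Set ℝ, volume N = 0 → (S ∩ N).Countable)
    (hL : ∀ M : Set ℝ, IsMeagre M → (L ∩ M).Countable) (hne : L.Nonempty) :
    MengerOn (S ×ˢ L) := by
  intro U hU
  have hS' : ∀ N : Set ℝ, (volume : Measure ℝ).toFinite N = 0 → (S ∩ N).Countable :=
    fun N hN => hS N (absolutelyContinuous_toFinite _ hN)
  obtain ⟨d, hdL, hd⟩ := exists_dense L hne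
  obtain ⟨V, N, O, hV, hN, hO, hdO, hcov⟩ := main_lemma (volume : Measure ℝ).toFinite S d U
    (fun n => (hU n).1) (fun n k s hs => (hU n).2 ⟨hs, hdL k⟩)
  have hcount := (lusin_diff hL d hd O hO hdO).union (countable_range d)
  obtain ⟨e, he⟩ := hcount.exists_eq_range ⟨d 0, Or.inr ⟨0, rfl⟩⟩
  have heL : ∀ k, e k ∈ L := by
    intro k
    have : e k ∈ L \ (⋂ m, O m) ∪ range d := he ▸ ⟨k, rfl⟩
    rcases this with h | ⟨j, hj⟩
    · exact h.1
    · exact hj ▸ hdL j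
  obtain ⟨V', N', O', hV', hN', hO', hdO', hcov'⟩ :=
    main_lemma (volume : Measure ℝ).toFinite S e U
      (fun n => (hU n).1) (fun n k s hs => (hU n).2 ⟨hs, heL k⟩)
  have hC : (S ∩ (N ∪ N')).Countable := hS' _ (measure_union_null hN hN')
  obtain ⟨W, hW, hWc⟩ := mengerOn_biUnion hC (fun c => {c} ×ˢ L)
    (fun c _ => mengerOn_vertical hL hne c) U fun n => ⟨(hU n).1, by
      refine Subset.trans ?_ (hU n).2
      exact iUnion₂_subset fun c hc => prod_mono_left (singleton_subset_iff.2 hc.1)⟩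
  obtain ⟨X, hX, h1, h2⟩ := cov_union hV hV'
  obtain ⟨Y, hY, h3, h4⟩ := cov_union hX hW
  refine ⟨Y, hY, ?_⟩
  rintro ⟨s, y⟩ ⟨hs, hy⟩
  by_cases hsN : s ∈ N ∪ N'
  · exact h4 (hWc (mem_iUnion₂.2 ⟨s, ⟨hs, hsN⟩, rfl, hy⟩))
  · have hn1 : s ∉ N := fun h => hsN (Or.inl h)
    have hn2 : s ∉ N' := fun h => hsN (Or.inr h)
    by_cases hyO : y ∈ ⋂ m, O m
    · exact h3 (h1 (hcov s hs hn1 y (mem_iInter.1 hyO)))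
    · have : y ∈ range e := he ▸ Or.inl ⟨hy, hyO⟩
      obtain ⟨k, rfl⟩ := this
      exact h3 (h2 (hcov' s hs hn2 _ fun m => hdO' m k))

/-- The product of a Sierpiński set and a Lusin set has Menger's property. -/
theorem sierpinski_prod_lusin_menger (S L : Set ℝ)
    (hS : IsSierpinskiSet S) (hL : IsLusinSet L) :
    MengerProp (↥S × ↥L) := by
  have hne : L.Nonempty := by
    rw [nonempty_iff_ne_empty]
    rintro rfl
    exact hL.1 countable_empty
  intro U hU
  let f : ↥S × ↥L → ℝ × ℝ := Prod.map Subtype.val Subtype.val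
  have hf : Topology.IsInducing f :=
    Topology.IsInducing.subtypeVal.prodMap Topology.IsInducing.subtypeVal
  obtain ⟨V, hV, hcov⟩ := mengerOn_prod hS.2 hL.2 hne
    (fun n => {O | IsOpen O ∧ f ⁻¹' O ∈ U n}) fun n => ⟨fun u hu => hu.1, by
      rintro ⟨s, y⟩ ⟨hs, hy⟩
      have : ((⟨s, hs⟩, ⟨y, hy⟩) : ↥S × ↥L) ∈ ⋃₀ U n := (hU n).2 ▸ mem_univ _
      obtain ⟨u, hu, hmem⟩ := this
      obtain ⟨O, hO, rfl⟩ := hf.isOpen_iff.1 ((hU n).1 u hu)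
      exact ⟨O, ⟨hO, hu⟩, hmem⟩⟩
  refine ⟨fun n => (fun O => f ⁻¹' O) '' V n, fun n => ⟨?_, (hV n).2.image _⟩, ?_⟩
  · rintro _ ⟨O, hO, rfl⟩
    exact ((hV n).1 hO).2
  · refine eq_univ_of_forall fun p => ?_
    obtain ⟨n, O, hO, hp⟩ := mem_iUnion.1 (hcov (show f p ∈ S ×ˢ L from ⟨p.1.2, p.2.2⟩))
    exact mem_iUnion.2 ⟨n, f ⁻¹' O, ⟨O, hO, rfl⟩, hp⟩
end

section
/- There exist an uncountable set X ⊆ ℝ and a countable family of continuous functions f_n : ℝ → ℝ (n ∈ ℕ) such that for every pair (x, y) ∈ X × X there is some n with y = f_n(x) or x = f_n(y); that is, X × X is covered by the graphs of the f_n together with the inverses of these graphs. -/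
/-- The `n`-th projection of Cantor space, leaving the zeroth block of coordinates free. -/
def cantorProj (n : ℕ) (x : ℕ → Bool) : ℕ → Bool := fun k => x (Nat.pair (n + 1) k)

theorem cantorProj_continuous (n : ℕ) : Continuous (cantorProj n) := by
  unfold cantorProj
  fun_prop

/-- Every sequence in Cantor space is coded by a point outside of it. -/
theorem exists_code (a : ℕ → ℕ → Bool) :
    ∃ x : ℕ → Bool, (∀ n, x ≠ a n) ∧ ∀ n, cantorProj n x = a n := by
  refine ⟨fun m => if m.unpair.1 = 0 then ! (a m.unpair.2 m)
    else a (m.unpair.1 - 1) m.unpair.2, ?_, ?_⟩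
  · intro n h
    have := congrFun h (Nat.pair 0 n)
    simp at this
  · intro n
    funext k
    simp [cantorProj]

theorem exists_uncountable_cantor :
    ∃ X : Set (ℕ → Bool), ¬ X.Countable ∧
      ∀ x ∈ X, ∀ y ∈ X, x = y ∨ ∃ n, y = cantorProj n x ∨ x = cantorProj n y := by
  obtain ⟨X, hX⟩ := zorn_subset
    {X : Set (ℕ → Bool) | ∀ x ∈ X, ∀ y ∈ X,
      x = y ∨ ∃ n, y = cantorProj n x ∨ x = cantorProj n y} (by
    intro c hc hch
    refine ⟨⋃₀ c, ?_, fun s hs => Set.subset_sUnion_of_mem hs⟩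
    rintro x ⟨s, hs, hxs⟩ y ⟨t, ht, hyt⟩
    rcases hch.total hs ht with h | h
    · exact hc ht x (h hxs) y hyt
    · exact hc hs x hxs y (h hyt))
  refine ⟨X, fun hcount => ?_, hX.prop⟩
  obtain ⟨a, ha⟩ : ∃ a : ℕ → ℕ → Bool, X ⊆ Set.range a :=
    Set.countable_iff_exists_subset_range.1 hcount
  obtain ⟨z, hz, hcode⟩ := exists_code a
  have hzX : z ∉ X := fun h => by
    obtain ⟨n, hn⟩ := ha h
    exact hz n hn.symm
  refine hzX (hX.le_of_ge (y := insert z X) ?_ (Set.subset_insert z X) (Set.mem_insert z X))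
  rintro x (rfl | hx) y (rfl | hy)
  · exact Or.inl rfl
  · obtain ⟨n, rfl⟩ := ha hy
    exact Or.inr ⟨n, Or.inl (hcode n).symm⟩
  · obtain ⟨n, rfl⟩ := ha hx
    exact Or.inr ⟨n, Or.inr (hcode n).symm⟩
  · exact hX.prop x hx y hy

/-- There is an uncountable set `X ⊆ ℝ` and countably many continuous real
functions whose graphs together with their inverses cover `X × X`. -/
theorem uncountable_square_covered_by_continuous_functions :
    ∃ (X : Set ℝ) (f : ℕ → ℝ → ℝ),
      ¬ X.Countable ∧ (∀ n, Continuous (f n)) ∧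
      ∀ x ∈ X, ∀ y ∈ X, ∃ n, y = f n x ∨ x = f n y := by
  obtain ⟨X, hX, hcov⟩ := exists_uncountable_cantor
  obtain ⟨e, -, hec, hei⟩ :=
    (isClosed_univ (X := ℝ)).exists_nat_bool_injection_of_not_countable Set.not_countable_univ
  have he := hec.isClosedEmbedding hei
  have hext : ∀ n, ∃ g : C(ℝ, ℝ), ∀ x, g (e x) = e (cantorProj n x) := fun n => by
    obtain ⟨g, hg⟩ := ContinuousMap.exists_extension' he
      (⟨fun x => e (cantorProj n x), hec.comp (cantorProj_continuous n)⟩ : C(ℕ → Bool, ℝ))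
    exact ⟨g, fun x => congrFun hg x⟩
  choose g hg using hext
  refine ⟨e '' X, fun n => Nat.casesOn n id (fun m => g m), ?_, ?_, ?_⟩
  · intro h
    exact hX (Set.countable_of_injective_of_countable_image hei.injOn h)
  · rintro (_ | n)
    · exact continuous_id
    · exact (g n).continuous
  · rintro _ ⟨x, hx, rfl⟩ _ ⟨y, hy, rfl⟩
    rcases hcov x hx y hy with rfl | ⟨n, rfl | rfl⟩
    · exact ⟨0, Or.inl rfl⟩
    · exact ⟨n + 1, Or.inl (hg n x).symm⟩
    · exact ⟨n + 1, Or.inr (hg n y).symm⟩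
end

section
/- Assuming every set of size ℵ₁ can be indexed by the ordinal ω₁: there exist countably many functions f_n : ω₁ → ω₁ (n ∈ ℕ) such that for every pair of ordinals α, β < ω₁ there is some n with β = f_n(α) or α = f_n(β); that is, ω₁ × ω₁ is covered by countably many graphs of functions and inverses of functions. -/
/-- Sierpiński's theorem: the square `ω₁ × ω₁` of the first uncountable
ordinal is covered by countably many graphs of functions `ω₁ → ω₁` together
with the inverses of such graphs. -/
theorem sierpinski_omega1_square_covered :
    ∃ f : ℕ → {o : Ordinal // o < (Cardinal.aleph 1).ord} →
      {o : Ordinal // o < (Cardinal.aleph 1).ord},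
      ∀ α β : {o : Ordinal // o < (Cardinal.aleph 1).ord},
        ∃ n, β = f n α ∨ α = f n β := by
  have hc : ∀ α : {o : Ordinal // o < (Cardinal.aleph 1).ord}, (Set.Iic α).Countable := by
    intro α
    have h1 : α.1.card ≤ Cardinal.aleph0 := by
      have h := Cardinal.lt_ord.1 α.2
      rwa [← Order.lt_succ_iff, Cardinal.succ_aleph0]
    have h2 : (Set.Iio α.1).Countable := by
      rw [← Cardinal.le_aleph0_iff_set_countable, Cardinal.mk_Iio_ordinal]
      exact Cardinal.lift_le_aleph0.2 h1
    have h3 : (Set.Iic α.1).Countable := by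
      rw [← Set.Iio_insert]
      exact h2.insert _
    exact h3.preimage Subtype.val_injective
  have hf : ∀ α, ∃ g : ℕ → {o : Ordinal // o < (Cardinal.aleph 1).ord},
      Set.Iic α = Set.range g := fun α => (hc α).exists_eq_range ⟨α, le_refl α⟩
  choose g hg using hf
  refine ⟨fun n α => g α n, fun α β => ?_⟩
  rcases le_total β α with h | h
  · have h' : β ∈ Set.range (g α) := hg α ▸ h
    obtain ⟨n, hn⟩ := h'
    exact ⟨n, Or.inl hn.symm⟩
  · have h' : α ∈ Set.range (g β) := hg β ▸ h
    obtain ⟨n, hn⟩ := h'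
    exact ⟨n, Or.inr hn.symm⟩
end

section
/- There exists a van Douwen MAD family, i.e., an infinite family A ⊆ ℕ^ℕ of functions that is pairwise almost disjoint and such that for every infinite partial function p : S → ℕ (S ⊆ ℕ infinite) there exists f ∈ A with {n ∈ S : p(n) = f(n)} infinite. -/
/-- A van Douwen MAD family: an infinite pairwise almost disjoint family of
functions `ℕ → ℕ` which is maximal even with respect to infinite partial
functions. -/
def IsVanDouwenMAD (A : Set (ℕ → ℕ)) : Prop :=
  A.Infinite ∧
    (∀ f ∈ A, ∀ g ∈ A, f ≠ g → {n : ℕ | f n = g n}.Finite) ∧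
    ∀ S : Set ℕ, S.Infinite → ∀ p : ℕ → ℕ,
      ∃ f ∈ A, {n ∈ S | p n = f n}.Infinite

/-- Codes for infinite partial functions: a domain and a total extension. -/
abbrev PF := Set ℕ × (ℕ → ℕ)

/-- An almost disjoint family of total functions indexed by `PF × ℕ`. -/
theorem exists_ad_family : ∃ g : PF → ℕ → ℕ → ℕ, ∀ a n b m,
    (a, n) ≠ (b, m) → ∀ᶠ k in Filter.cofinite, g a n k ≠ g b m k := by
  classical
  let φ : PF → ℕ → ℕ → ℕ := fun a n k =>
    Nat.pair n (Nat.pair (if k ∈ a.1 then 1 else 0) (a.2 k))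
  refine ⟨fun a n k => Encodable.encode ((List.range k).map (φ a n)), ?_⟩
  intro a n b m hne
  have hφ : ∃ j, φ a n j ≠ φ b m j := by
    by_contra! h
    apply hne
    have h1 : ∀ j, n = m ∧ (j ∈ a.1 ↔ j ∈ b.1) ∧ a.2 j = b.2 j := by
      intro j
      have := h j
      simp only [φ, Nat.pair_eq_pair] at this
      refine ⟨this.1, ?_, this.2.2⟩
      have h2 := this.2.1
      split_ifs at h2 <;> simp_all
    refine Prod.ext (Prod.ext ?_ ?_) (h1 0).1
    · ext j; exact (h1 j).2.1
    · funext j; exact (h1 j).2.2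
  obtain ⟨j, hj⟩ := hφ
  rw [Nat.cofinite_eq_atTop]
  filter_upwards [Filter.eventually_gt_atTop j] with k hk h
  have h := Encodable.encode_injective h
  rw [List.map_inj_left] at h
  exact hj (h j (List.mem_range.2 hk))

/-- There is a van Douwen MAD family (in ZFC). -/
theorem exists_vanDouwen_MAD : ∃ A : Set (ℕ → ℕ), IsVanDouwenMAD A := by
  classical
  obtain ⟨g, hg⟩ := exists_ad_family
  -- a maximal almost disjoint family `H` of partial functions almost disjoint from all `g a n`
  let P : Set (Set PF) := {H | (∀ a ∈ H, ∀ b n, ∀ᶠ k in Filter.cofinite, k ∈ a.1 → a.2 k ≠ g b n k) ∧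
    ∀ a ∈ H, ∀ b ∈ H, a ≠ b →
      ∀ᶠ k in Filter.cofinite, k ∈ a.1 → k ∈ b.1 → a.2 k ≠ b.2 k}
  obtain ⟨H, hH⟩ : ∃ H, Maximal (· ∈ P) H := by
    refine zorn_subset P ?_
    intro c hc hchain
    refine ⟨⋃₀ c, ⟨?_, ?_⟩, fun s hs => Set.subset_sUnion_of_mem hs⟩
    · rintro a ⟨s, hs, ha⟩
      exact (hc hs).1 a ha
    · rintro a ⟨s, hs, ha⟩ b ⟨t, ht, hb⟩ hab
      rcases hchain.total hs ht with h | h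
      · exact (hc ht).2 a (h ha) b hb hab
      · exact (hc hs).2 a ha b (h hb) hab
  obtain ⟨hW, hA⟩ := hH.prop
  -- shift along `D = dom a`: the piece of `g a n` on `D` is moved to the function `n + 1`
  let f : PF → ℕ → ℕ → ℕ := fun a n k =>
    if a ∈ H ∧ k ∈ a.1 then (match n with | 0 => a.2 k | n + 1 => g a n k) else g a n k
  have hf : ∀ a n b m, (a, n) ≠ (b, m) → ∀ᶠ k in Filter.cofinite, f a n k ≠ f b m k := by
    have hg' : ∀ a n b m, ∀ᶠ k in Filter.cofinite, (a, n) ≠ (b, m) → g a n k ≠ g b m k := by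
      intro a n b m
      by_cases h : (a, n) = (b, m)
      · simp [h]
      · filter_upwards [hg a n b m h] with k hk _ using hk
    have hW' : ∀ a b n, ∀ᶠ k in Filter.cofinite, a ∈ H → k ∈ a.1 → a.2 k ≠ g b n k := by
      intro a b n
      by_cases h : a ∈ H
      · filter_upwards [hW a h b n] with k hk _ using hk
      · simp [h]
    have hA' : ∀ a b, ∀ᶠ k in Filter.cofinite, a ∈ H → b ∈ H → a ≠ b → k ∈ a.1 → k ∈ b.1 →
        a.2 k ≠ b.2 k := by
      intro a b
      by_cases h : a ∈ H ∧ b ∈ H ∧ a ≠ b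
      · filter_upwards [hA a h.1 b h.2.1 h.2.2] with k hk _ _ _ using hk
      · exact Filter.Eventually.of_forall fun k h1 h2 h3 => (h ⟨h1, h2, h3⟩).elim
    intro a n b m hne
    filter_upwards [hg' a n b m, hg' a (n-1) b m, hg' a n b (m-1), hg' a (n-1) b (m-1),
      hW' a b m, hW' a b (m-1), hW' b a n, hW' b a (n-1), hA' a b] with k h1 h2 h3 h4 h5 h6 h7 h8 h9
    rcases n with _ | n <;> rcases m with _ | m <;>
      simp only [f, Nat.add_sub_cancel, ne_eq, Prod.mk.injEq] at * <;> grind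
  refine ⟨Set.range fun i : PF × ℕ => f i.1 i.2, ?_, ?_, ?_⟩
  · apply Set.infinite_range_of_injective
    rintro ⟨a, n⟩ ⟨b, m⟩ h
    by_contra hne
    obtain ⟨k, hk⟩ := (hf a n b m hne).exists
    exact hk (congrFun h k)
  · rintro _ ⟨⟨a, n⟩, rfl⟩ _ ⟨⟨b, m⟩, rfl⟩ hne
    have := hf a n b m (by rintro h; apply hne; simp_all)
    simpa [Filter.eventually_cofinite] using this
  · intro S hS p
    by_contra! hcon
    have hcon : ∀ a n, ∀ᶠ k in Filter.cofinite, k ∈ S → p k ≠ f a n k := by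
      intro a n
      have := hcon _ ⟨(a, n), rfl⟩
      rw [Filter.eventually_cofinite]
      simpa using this
    have hpg : ∀ b n, ∀ᶠ k in Filter.cofinite, k ∈ S → p k ≠ g b n k := by
      intro b n
      filter_upwards [hcon b n, hcon b (n+1)] with k h1 h2 hk
      simp only [f] at h1 h2
      grind
    have hpH : ∀ a ∈ H, ∀ᶠ k in Filter.cofinite, k ∈ S → k ∈ a.1 → p k ≠ a.2 k := by
      intro a ha
      filter_upwards [hcon a 0] with k h1 hk hka
      simpa [f, ha, hka] using h1 hk
    have hmem : insert ((S, p) : PF) H ∈ P := by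
      refine ⟨?_, ?_⟩
      · rintro a (rfl | ha)
        · exact hpg
        · exact hW a ha
      · rintro a (rfl | ha) b (rfl | hb) hab
        · exact (hab rfl).elim
        · exact hpH b hb
        · filter_upwards [hpH a ha] with k hk h1 h2 h3 using hk h2 h1 h3.symm
        · exact hA a ha b hb hab
    have hin : ((S, p) : PF) ∈ H := hH.le_of_ge hmem (Set.subset_insert _ _) (Set.mem_insert _ _)
    have := hpH _ hin
    rw [Filter.eventually_cofinite] at this
    exact hS (by simpa using this)
end

section
/- No van Douwen MAD family is analytic: if A ⊆ ℕ^ℕ is an infinite pairwise almost disjoint family of functions such that for every infinite set S ⊆ ℕ and every p : S → ℕ there is f ∈ A with {n ∈ S : p(n) = f(n)} infinite, then A is not an analytic subset of the Baire space ℕ^ℕ. -/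
namespace VDMad

open Set PiNat

/-- Positive sets: not almost covered by finitely many members of `A`. -/
def Pos (A : Set (Set ℕ)) (x : Set ℕ) : Prop :=
  ∀ S : Set (Set ℕ), S.Finite → S ⊆ A → (x \ ⋃₀ S).Infinite

theorem Pos.infinite {A : Set (Set ℕ)} {x : Set ℕ} (h : Pos A x) : x.Infinite := by
  have := h ∅ finite_empty (empty_subset _)
  simpa using this

theorem Pos.diff {A : Set (Set ℕ)} {x : Set ℕ} (h : Pos A x) {S : Set (Set ℕ)}
    (hS : S.Finite) (hSA : S ⊆ A) : Pos A (x \ ⋃₀ S) := by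
  intro S' hS' hSA'
  have := h (S ∪ S') (hS.union hS') (union_subset hSA hSA')
  rwa [sUnion_union, ← diff_diff] at this

/-- A set that is met infinitely by infinitely many members of `A` is positive. -/
theorem pos_of_infinite {A : Set (Set ℕ)}
    (had : ∀ a ∈ A, ∀ b ∈ A, a ≠ b → (a ∩ b).Finite) {x : Set ℕ}
    (h : {a ∈ A | (a ∩ x).Infinite}.Infinite) : Pos A x := by
  intro S hS hSA
  obtain ⟨a, ⟨haA, hax⟩, haS⟩ := h.exists_notMem_finite hS
  have hfin : (⋃ b ∈ S, a ∩ b).Finite := by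
    refine hS.biUnion fun b hb => had a haA b (hSA hb) ?_
    rintro rfl
    exact haS hb
  refine (hax.diff hfin).mono ?_
  rintro k ⟨⟨hka, hkx⟩, hk⟩
  refine ⟨hkx, ?_⟩
  rintro ⟨b, hb, hkb⟩
  exact hk (mem_biUnion hb ⟨hka, hkb⟩)

/-- Infinite choice along infinite sets of naturals. -/
theorem exists_choice (z : ℕ → Set ℕ) (hz : ∀ n, (z n).Infinite) :
    ∃ f : ℕ → ℕ, ∀ n, f n ∈ z n ∧ n < f n := by
  have : ∀ n, ∃ k, k ∈ z n ∧ n < k := fun n => by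
    obtain ⟨k, hk, hnk⟩ := (hz n).exists_gt n
    exact ⟨k, hk, hnk⟩
  choose f hf using this
  exact ⟨f, hf⟩

theorem range_diff_finite {x : ℕ → Set ℕ} (hx : Antitone x) {f : ℕ → ℕ}
    (hf : ∀ n, f n ∈ x n) (n : ℕ) : (range f \ x n).Finite := by
  refine ((finite_lt_nat n).image f).subset ?_
  rintro _ ⟨⟨i, rfl⟩, hi⟩
  refine ⟨i, ?_, rfl⟩
  by_contra hni
  exact hi (hx (not_lt.1 hni) (hf i))

theorem infinite_range_of_lt {f : ℕ → ℕ} (hf : ∀ n, n < f n) : (range f).Infinite :=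
  infinite_of_forall_exists_gt fun n => ⟨f n, ⟨n, rfl⟩, hf n⟩

/-- Decreasing sequences of positive sets have positive pseudo-intersections. -/
theorem exists_pseudo {A : Set (Set ℕ)}
    (had : ∀ a ∈ A, ∀ b ∈ A, a ≠ b → (a ∩ b).Finite)
    (hmax : ∀ y : Set ℕ, y.Infinite → ∃ a ∈ A, (a ∩ y).Infinite)
    {x : ℕ → Set ℕ} (hx : Antitone x) (hpos : ∀ n, Pos A (x n)) :
    ∃ y, Pos A y ∧ ∀ n, (y \ x n).Finite := by
  have hI : {a ∈ A | ∀ n, (a ∩ x n).Infinite}.Infinite := by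
    intro hS
    set S := {a ∈ A | ∀ n, (a ∩ x n).Infinite} with hSdef
    have hSA : S ⊆ A := fun a ha => ha.1
    obtain ⟨f, hf⟩ := exists_choice (fun n => x n \ ⋃₀ S) (fun n => hpos n S hS hSA)
    have hanti : Antitone (fun n => x n \ ⋃₀ S) := fun i j hij =>
      diff_subset_diff_left (hx hij)
    obtain ⟨a, haA, ha⟩ := hmax _ (infinite_range_of_lt fun n => (hf n).2)
    have key : ∀ n, (a ∩ (x n \ ⋃₀ S)).Infinite := by
      intro n
      refine (ha.diff (range_diff_finite hanti (fun n => (hf n).1) n)).mono ?_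
      rintro k ⟨⟨hka, hkr⟩, hk⟩
      refine ⟨hka, ?_⟩
      by_contra hc
      exact hk ⟨hkr, hc⟩
    have haS : a ∈ S := ⟨haA, fun n => (key n).mono fun k hk => ⟨hk.1, hk.2.1⟩⟩
    obtain ⟨k, hk⟩ := (key 0).nonempty
    exact hk.2.2 ⟨a, haS, hk.1⟩
  let e := hI.natEmbedding
  obtain ⟨f, hf⟩ := exists_choice (fun n => (e (Nat.unpair n).2 : Set ℕ) ∩ x n)
    (fun n => (e (Nat.unpair n).2).2.2 n)
  refine ⟨range f, ?_, range_diff_finite hx fun n => (hf n).1.2⟩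
  refine pos_of_infinite had ?_
  have : (range fun k => (e k : Set ℕ)).Infinite :=
    infinite_range_of_injective (Subtype.val_injective.comp e.injective)
  refine this.mono ?_
  rintro _ ⟨k, rfl⟩
  refine ⟨(e k).2.1, ?_⟩
  refine infinite_of_forall_exists_gt fun j => ⟨f (Nat.pair j k), ⟨?_, ⟨_, rfl⟩⟩, ?_⟩
  · have := (hf (Nat.pair j k)).1.1
    simpa using this
  · exact lt_of_le_of_lt (Nat.left_le_pair j k) (hf _).2

/-- A positive set deciding all cylinders. -/
theorem exists_deciding {F : (ℕ → ℕ) → Set ℕ}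
    (had : ∀ a ∈ range F, ∀ b ∈ range F, a ≠ b → (a ∩ b).Finite)
    (hmax : ∀ y : Set ℕ, y.Infinite → ∃ a ∈ range F, (a ∩ y).Infinite)
    (h0 : Pos (range F) univ) :
    ∃ x, Pos (range F) x ∧ ∀ w m, (∀ v ∈ cylinder w m, (F v ∩ x).Finite) ∨
      (∀ y ⊆ x, Pos (range F) y → ∃ v ∈ cylinder w m, (F v ∩ y).Infinite) := by
  obtain ⟨l, hl⟩ := exists_surjective_nat (List ℕ)
  let N : ℕ → Set (ℕ → ℕ) := fun n => {w | res w (l n).length = l n}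
  have step : ∀ (n : ℕ) (x : {x // Pos (range F) x}), ∃ y : {x // Pos (range F) x},
      y.1 ⊆ x.1 ∧ ((∀ v ∈ N n, (F v ∩ y.1).Finite) ∨
        ∀ y' ⊆ y.1, Pos (range F) y' → ∃ v ∈ N n, (F v ∩ y').Infinite) := by
    intro n x
    by_cases h : ∃ y ⊆ x.1, Pos (range F) y ∧ ∀ v ∈ N n, (F v ∩ y).Finite
    · obtain ⟨y, hyx, hy, hy'⟩ := h
      exact ⟨⟨y, hy⟩, hyx, Or.inl hy'⟩
    · refine ⟨x, Subset.rfl, Or.inr fun y' hy' hp => ?_⟩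
      by_contra hc
      refine h ⟨y', hy', hp, fun v hv => ?_⟩
      by_contra hi
      exact hc ⟨v, hv, hi⟩
  choose g hg1 hg2 using step
  let x : ℕ → {x // Pos (range F) x} := fun n => Nat.rec ⟨univ, h0⟩ (fun n x => g n x) n
  have hxs : ∀ n, x (n + 1) = g n (x n) := fun n => rfl
  have hanti : Antitone fun n => (x n).1 := antitone_nat_of_succ_le fun n => by
    rw [hxs]; exact hg1 n (x n)
  obtain ⟨y, hy, hyx⟩ := exists_pseudo had hmax hanti fun n => (x n).2
  refine ⟨y, hy, fun w m => ?_⟩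
  obtain ⟨n, hn⟩ := hl (res w m)
  have hN : cylinder w m = N n := by
    rw [cylinder_eq_res]
    simp only [N, hn, res_length]
  rw [hN]
  have hfin := hyx (n + 1)
  rcases hg2 n (x n) with h | h
  · left
    intro v hv
    refine ((h v hv).union hfin).subset ?_
    rintro k ⟨hk, hky⟩
    by_cases hkx : k ∈ (x (n + 1)).1
    · exact Or.inl ⟨hk, hkx⟩
    · exact Or.inr ⟨hky, hkx⟩
  · right
    intro y' hy' hp
    have hp' : Pos (range F) (y' ∩ (x (n + 1)).1) := by
      intro S hS hSA
      refine ((hp S hS hSA).diff hfin).mono ?_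
      rintro k ⟨⟨hk1, hk2⟩, hk3⟩
      refine ⟨⟨hk1, ?_⟩, hk2⟩
      by_contra hc
      exact hk3 ⟨hy' hk1, hc⟩
    obtain ⟨v, hv, hvi⟩ := h _ inter_subset_right hp'
    exact ⟨v, hv, hvi.mono fun k hk => ⟨hk.1, hk.2.1⟩⟩

/-- Limits of nested cylinders. -/
theorem exists_limit (w : ℕ → ℕ → ℕ) (m : ℕ → ℕ) (hm : ∀ n, m n < m (n + 1))
    (hw : ∀ n, w (n + 1) ∈ cylinder (w n) (m n)) : ∃ u, ∀ n, u ∈ cylinder (w n) (m n) := by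
  have hmono : StrictMono m := strictMono_nat_of_lt_succ hm
  have hle : ∀ n j, n ≤ j → ∀ i < m n, w j i = w n i := by
    intro n j hj
    induction j, hj using Nat.le_induction with
    | base => intro i _; rfl
    | succ j hj ih =>
      intro i hi
      rw [← ih i hi]
      exact hw j i (lt_of_lt_of_le hi (hmono.monotone hj))
  refine ⟨fun i => w (i + 1) i, fun n i hi => ?_⟩
  rcases le_total n (i + 1) with h | h
  · exact hle n (i + 1) h i hi
  · exact (hle (i + 1) n h i (lt_of_lt_of_le (Nat.lt_succ_self i) (hmono.le_apply))).symm

/-- Theorem of Mathias: no infinite analytic MAD family. -/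
theorem mathias {F : (ℕ → ℕ) → Set ℕ}
    (hF : ∀ w k, ∃ m, ∀ v ∈ cylinder w m, (k ∈ F v ↔ k ∈ F w))
    (had : ∀ a ∈ range F, ∀ b ∈ range F, a ≠ b → (a ∩ b).Finite)
    (hmax : ∀ y : Set ℕ, y.Infinite → ∃ a ∈ range F, (a ∩ y).Infinite)
    (hinf : (range F).Infinite) (hinf' : ∀ w, (F w).Infinite) : False := by
  have h0 : Pos (range F) univ := by
    refine pos_of_infinite had (hinf.mono ?_)
    rintro _ ⟨w, rfl⟩
    exact ⟨⟨w, rfl⟩, by simpa using hinf' w⟩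
  obtain ⟨x, hx, hdec⟩ := exists_deciding had hmax h0
  have hdec' : ∀ w m, (F w ∩ x).Infinite →
      ∀ y ⊆ x, Pos (range F) y → ∃ v ∈ cylinder w m, (F v ∩ y).Infinite := by
    intro w m hw
    rcases hdec w m with h | h
    · exact absurd (h w (self_mem_cylinder w m)) hw
    · exact h
  -- the complement of `O` is not positive
  let O : (ℕ → ℕ) → ℕ → Set ℕ := fun w m =>
    {k | ∃ v ∈ cylinder w m, (F v ∩ x).Infinite ∧ k ∈ F v}
  have hO : ∀ w m, (F w ∩ x).Infinite →
      ∃ S : Set (Set ℕ), S.Finite ∧ S ⊆ range F ∧ ((x \ O w m) \ ⋃₀ S).Finite := by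
    intro w m hw
    by_contra hc
    have hp : Pos (range F) (x \ O w m) := by
      intro S hS hSA
      by_contra hfin
      exact hc ⟨S, hS, hSA, not_infinite.1 hfin⟩
    obtain ⟨v, hv, hvi⟩ := hdec' w m hw _ diff_subset hp
    obtain ⟨k, hk⟩ := hvi.nonempty
    exact hk.2.2 ⟨v, hv, hvi.mono fun k hk => ⟨hk.1, hk.2.1⟩, hk.1⟩
  have hOO : ∀ w m w' m', (F w ∩ x).Infinite → (F w' ∩ x).Infinite →
      (O w m ∩ O w' m').Infinite := by
    intro w m w' m' hw hw'
    obtain ⟨S, hS, hSA, hSf⟩ := hO w m hw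
    obtain ⟨S', hS', hSA', hSf'⟩ := hO w' m' hw'
    have := hx (S ∪ S') (hS.union hS') (union_subset hSA hSA')
    refine (this.diff (hSf.union hSf')).mono ?_
    rintro k ⟨⟨hkx, hkS⟩, hk⟩
    rw [sUnion_union] at hkS
    constructor
    · by_contra hc
      exact hk (Or.inl ⟨⟨hkx, hc⟩, fun h => hkS (Or.inl h)⟩)
    · by_contra hc
      exact hk (Or.inr ⟨⟨hkx, hc⟩, fun h => hkS (Or.inr h)⟩)
  -- two separated branches
  obtain ⟨w₁, hw₁⟩ : ∃ w, (F w ∩ x).Infinite := by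
    obtain ⟨_, ⟨w, rfl⟩, h⟩ := hmax x hx.infinite
    exact ⟨w, h⟩
  obtain ⟨w₂, hw₂, hne⟩ : ∃ w, (F w ∩ x).Infinite ∧ F w ≠ F w₁ := by
    have hp := hx {F w₁} (finite_singleton _) (by simp)
    obtain ⟨_, ⟨w, rfl⟩, h⟩ := hmax _ hp
    refine ⟨w, h.mono fun k hk => ⟨hk.1, hk.2.1⟩, fun heq => ?_⟩
    obtain ⟨k, hk⟩ := h.nonempty
    exact hk.2.2 ⟨_, rfl, heq ▸ hk.1⟩
  obtain ⟨k₀, hk₀⟩ : ∃ k, ¬ (k ∈ F w₂ ↔ k ∈ F w₁) := by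
    by_contra hc
    push Not at hc
    exact hne (Set.ext hc)
  obtain ⟨m₁, hm₁⟩ := hF w₁ k₀
  obtain ⟨m₂, hm₂⟩ := hF w₂ k₀
  -- the construction
  let P := {p : (ℕ → ℕ) × (ℕ → ℕ) × ℕ // (F p.1 ∩ x).Infinite ∧ (F p.2.1 ∩ x).Infinite}
  have step : ∀ (n : ℕ) (p : P), ∃ q : P, q.1.1 ∈ cylinder p.1.1 p.1.2.2 ∧
      q.1.2.1 ∈ cylinder p.1.2.1 p.1.2.2 ∧ p.1.2.2 < q.1.2.2 ∧
      ∃ k > n, (∀ v ∈ cylinder q.1.1 q.1.2.2, k ∈ F v) ∧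
        ∀ v ∈ cylinder q.1.2.1 q.1.2.2, k ∈ F v := by
    rintro n ⟨⟨a, b, m⟩, ha, hb⟩
    obtain ⟨k, ⟨⟨a', ha', hai, hka⟩, ⟨b', hb', hbi, hkb⟩⟩, hnk⟩ :=
      (hOO a m b m ha hb).exists_gt n
    obtain ⟨i, hi⟩ := hF a' k
    obtain ⟨j, hj⟩ := hF b' k
    refine ⟨⟨⟨a', b', max (m + 1) (max i j)⟩, hai, hbi⟩, ha', hb', ?_, k, hnk, ?_, ?_⟩
    · exact lt_of_lt_of_le (Nat.lt_succ_self m) (le_max_left _ _)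
    · intro v hv
      exact (hi v (cylinder_anti _ (by simp) hv)).2 hka
    · intro v hv
      exact (hj v (cylinder_anti _ (by simp) hv)).2 hkb
  choose g hg1 hg2 hg3 hg4 using step
  let p : ℕ → P := fun n => Nat.rec ⟨⟨w₁, w₂, max m₁ m₂⟩, hw₁, hw₂⟩ (fun n q => g n q) n
  have hps : ∀ n, p (n + 1) = g n (p n) := fun n => rfl
  have hlt : ∀ n, (p n).1.2.2 < (p (n + 1)).1.2.2 := fun n => hg3 n (p n)
  obtain ⟨u, hu⟩ := exists_limit (fun n => (p n).1.1) (fun n => (p n).1.2.2) hlt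
    (fun n => hg1 n (p n))
  obtain ⟨v, hv⟩ := exists_limit (fun n => (p n).1.2.1) (fun n => (p n).1.2.2) hlt
    (fun n => hg2 n (p n))
  have hu0 := hm₁ u (cylinder_anti _ (le_max_left m₁ m₂) (hu 0))
  have hv0 := hm₂ v (cylinder_anti _ (le_max_right m₁ m₂) (hv 0))
  have huv : F u ≠ F v := by
    intro h
    apply hk₀
    rw [← hu0, ← hv0, h]
  refine (infinite_of_forall_exists_gt fun n => ?_) (had (F u) ⟨u, rfl⟩ (F v) ⟨v, rfl⟩ huv)
  obtain ⟨k, hk, h1, h2⟩ := hg4 n (p n)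
  exact ⟨k, ⟨h1 u (hu (n + 1)), h2 v (hv (n + 1))⟩, hk⟩

theorem exists_cylinder_const {g : (ℕ → ℕ) → ℕ} (hg : Continuous g) (w : ℕ → ℕ) :
    ∃ m, ∀ v ∈ cylinder w m, g v = g w := by
  have ho : IsOpen (g ⁻¹' {g w}) := (isOpen_discrete _).preimage hg
  obtain ⟨_, ⟨x, n, rfl⟩, hw, hs⟩ :=
    (isTopologicalBasis_cylinders (fun _ : ℕ => ℕ)).exists_subset_of_mem_open
      (show w ∈ g ⁻¹' {g w} from rfl) ho
  refine ⟨n, fun v hv => hs ?_⟩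
  rwa [← mem_cylinder_iff_eq.1 hw]

/-- Graph of a function, coded as a set of naturals. -/
def gr (h : ℕ → ℕ) : Set ℕ := {k | (Nat.unpair k).2 = h (Nat.unpair k).1}

/-- Vertical column, coded as a set of naturals. -/
def col (n : ℕ) : Set ℕ := {k | (Nat.unpair k).1 = n}

theorem pair_mem_gr (h : ℕ → ℕ) (n : ℕ) : Nat.pair n (h n) ∈ gr h := by simp [gr]

theorem gr_infinite (h : ℕ → ℕ) : (gr h).Infinite := by
  refine (infinite_range_of_injective (f := fun n => Nat.pair n (h n)) ?_).mono ?_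
  · intro a b hab
    exact (Nat.pair_eq_pair.1 hab).1
  · rintro _ ⟨n, rfl⟩
    exact pair_mem_gr h n

theorem col_infinite (n : ℕ) : (col n).Infinite := by
  refine (infinite_range_of_injective (f := fun j => Nat.pair n j) ?_).mono ?_
  · intro a b hab
    exact (Nat.pair_eq_pair.1 hab).2
  · rintro _ ⟨j, rfl⟩
    simp [col]

theorem gr_injective : Function.Injective gr := by
  intro f g h
  funext n
  have : Nat.pair n (f n) ∈ gr g := h ▸ pair_mem_gr f n
  simpa [gr] using this

theorem gr_inter_col (f : ℕ → ℕ) (n : ℕ) : (gr f ∩ col n).Finite := by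
  refine (finite_singleton (Nat.pair n (f n))).subset ?_
  rintro k ⟨h1, h2⟩
  simp only [gr, col, mem_setOf_eq] at h1 h2
  rw [mem_singleton_iff, ← Nat.pair_unpair k, h1, h2]

theorem gr_inter_gr {f g : ℕ → ℕ} (h : {n : ℕ | f n = g n}.Finite) : (gr f ∩ gr g).Finite := by
  refine (h.image fun n => Nat.pair n (f n)).subset ?_
  rintro k ⟨h1, h2⟩
  simp only [gr, mem_setOf_eq] at h1 h2
  refine ⟨(Nat.unpair k).1, h1.symm.trans h2, ?_⟩
  simp only
  rw [← h1, Nat.pair_unpair]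

end VDMad

open VDMad Set PiNat in
/-- No van Douwen MAD family is an analytic subset of the Baire space. -/
theorem vanDouwenMAD_not_analytic (A : Set (ℕ → ℕ))
    (hinf : A.Infinite)
    (had : ∀ f ∈ A, ∀ g ∈ A, f ≠ g → {n : ℕ | f n = g n}.Finite)
    (hmax : ∀ S : Set ℕ, S.Infinite → ∀ p : ℕ → ℕ,
      ∃ f ∈ A, {n ∈ S | p n = f n}.Infinite) :
    ¬ MeasureTheory.AnalyticSet A := by
  intro hA
  rw [MeasureTheory.AnalyticSet] at hA
  rcases hA with rfl | ⟨f, hf, rfl⟩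
  · exact hinf finite_empty
  let F : (ℕ → ℕ) → Set ℕ := fun w =>
    if w 0 = 0 then gr (f fun i => w (i + 1)) else col (w 0 - 1)
  have hFg : ∀ u, gr (f u) ∈ range F := by
    intro u
    refine ⟨fun i => Nat.casesOn i 0 u, ?_⟩
    simp [F]
  have hFc : ∀ n, col n ∈ range F := by
    intro n
    refine ⟨fun _ => n + 1, ?_⟩
    simp [F]
  have hF' : ∀ a ∈ range F, (∃ u, a = gr (f u)) ∨ ∃ n, a = col n := by
    rintro _ ⟨w, rfl⟩
    by_cases h : w 0 = 0
    · left; exact ⟨fun i => w (i + 1), by simp [F, h]⟩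
    · right; exact ⟨w 0 - 1, by simp [F, h]⟩
  refine mathias (F := F) ?_ ?_ ?_ ?_ ?_
  · intro w k
    have hc : Continuous fun w : ℕ → ℕ => f (fun i => w (i + 1)) (Nat.unpair k).1 := by
      have h1 : Continuous fun w : ℕ → ℕ => f (fun i => w (i + 1)) :=
        hf.comp (continuous_pi fun i => continuous_apply (i + 1))
      exact (continuous_apply _).comp h1
    obtain ⟨m, hm⟩ := exists_cylinder_const hc w
    refine ⟨max m 1, fun v hv => ?_⟩
    have e1 := hm v (cylinder_anti _ (le_max_left _ _) hv)
    have e2 : v 0 = w 0 := hv 0 (by simp)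
    by_cases h : w 0 = 0
    · simp [F, e2, h, gr, e1]
    · simp [F, e2, h]
  · intro a ha b hb hab
    rcases hF' a ha with ⟨u, rfl⟩ | ⟨n, rfl⟩ <;> rcases hF' b hb with ⟨v, rfl⟩ | ⟨j, rfl⟩
    · exact gr_inter_gr (had _ ⟨u, rfl⟩ _ ⟨v, rfl⟩ fun h => hab (by rw [h]))
    · exact gr_inter_col _ _
    · rw [inter_comm]; exact gr_inter_col _ _
    · have : col n ∩ col j = ∅ := by
        ext k
        simp only [col, mem_inter_iff, mem_setOf_eq, mem_empty_iff_false, iff_false]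
        rintro ⟨rfl, rfl⟩
        exact hab rfl
      rw [this]; exact finite_empty
  · intro y hy
    by_cases hcol : ∃ n, (col n ∩ y).Infinite
    · obtain ⟨n, hn⟩ := hcol
      exact ⟨_, hFc n, hn⟩
    have hcol' : ∀ n, (col n ∩ y).Finite := fun n => by
      by_contra h; exact hcol ⟨n, h⟩
    let S : Set ℕ := (fun k => (Nat.unpair k).1) '' y
    have hS : S.Infinite := by
      intro hS
      refine hy ((hS.biUnion fun n _ => hcol' n).subset fun k hk => ?_)
      exact mem_biUnion (mem_image_of_mem _ hk) ⟨rfl, hk⟩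
    have hp : ∀ n, ∃ j, n ∈ S → Nat.pair n j ∈ y := by
      intro n
      by_cases hn : n ∈ S
      · obtain ⟨k, hk, rfl⟩ := hn
        exact ⟨(Nat.unpair k).2, fun _ => by simpa using hk⟩
      · exact ⟨0, fun h => absurd h hn⟩
    choose p hp using hp
    obtain ⟨_, ⟨u, rfl⟩, hu⟩ := hmax S hS p
    refine ⟨_, hFg u, ?_⟩
    refine (hu.image (f := fun n => Nat.pair n (p n)) ?_).mono ?_
    · intro a _ b _ hab
      exact (Nat.pair_eq_pair.1 hab).1
    · rintro _ ⟨n, ⟨hnS, hn⟩, rfl⟩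
      refine ⟨?_, hp n hnS⟩
      simpa [gr] using hn
  · refine (hinf.image (f := gr) gr_injective.injOn).mono ?_
    rintro _ ⟨_, ⟨u, rfl⟩, rfl⟩
    exact hFg u
  · intro w
    rcases hF' (F w) ⟨w, rfl⟩ with ⟨u, h⟩ | ⟨n, h⟩
    · rw [h]; exact gr_infinite _
    · rw [h]; exact col_infinite _
end

section
/- For every nonempty perfect set P ⊆ ℝ there exists a nonempty perfect set M ⊆ ℝ of Lebesgue measure zero such that P + M = ℝ, where P + M = {p + m : p ∈ P, m ∈ M}. -/
open MeasureTheory Set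
open scoped Pointwise

lemma step_cover (F : Finset ℝ) (R h : ℝ) (hR : 0 < R) (hh : 0 < h) (h1 : h ≤ 1)
    (hF : ∀ s ∈ F, s ∈ Icc (-R) R)
    (hsep : ∀ s ∈ F, ∀ t ∈ F, s < t → s + h ≤ t)
    (E : Set ℝ) (hE : MeasurableSet E) (hE1 : E ⊆ Icc 0 1) :
    ∃ y : ℝ, MeasurableSet ((F : Set ℝ) + Ico y (y + h)) ∧
      volume.real (E \ ((F : Set ℝ) + Ico y (y + h))) ≤
        (1 - F.card * h / (2 * R + 2)) * volume.real E := by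
  have hG : ∀ y, ((F : Set ℝ) + Ico y (y + h)) = ⋃ s ∈ F, Ico (s + y) (s + y + h) := by
    intro y
    ext z
    simp only [mem_add, mem_iUnion, mem_Ico, Finset.mem_coe, exists_prop]
    constructor
    · rintro ⟨s, hs, t, ht, rfl⟩
      exact ⟨s, hs, by linarith, by linarith⟩
    · rintro ⟨s, hs, ht, ht'⟩
      exact ⟨s, hs, z - s, ⟨by linarith, by linarith⟩, by ring⟩
  have hGm : ∀ y, MeasurableSet ((F : Set ℝ) + Ico y (y + h)) := by
    intro y
    rw [hG]
    exact Finset.measurableSet_biUnion _ fun _ _ => measurableSet_Ico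
  have hEfin : volume E ≠ ⊤ := ((measure_mono hE1).trans_lt (by simp)).ne
  -- the measure of the intersection is a sum
  have hsum : ∀ y, volume (E ∩ ((F : Set ℝ) + Ico y (y + h)))
      = ∑ s ∈ F, volume (E ∩ Ico (s + y) (s + y + h)) := by
    intro y
    rw [hG, inter_iUnion₂]
    apply measure_biUnion_finset
    · intro s hs t ht hst
      rw [Function.onFun, Set.disjoint_left]
      rintro z ⟨-, hz1, hz2⟩ ⟨-, hz3, hz4⟩
      rcases lt_or_gt_of_ne hst with hlt | hlt
      · have := hsep s hs t ht hlt
        linarith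
      · have := hsep t ht s hs hlt
        linarith
    · intro s hs
      exact hE.inter measurableSet_Ico
  have hmeas : ∀ s : ℝ, MeasurableSet {q : ℝ × ℝ | q.2 ∈ E ∩ Ico (s + q.1) (s + q.1 + h)} := by
    intro s
    have e : {q : ℝ × ℝ | q.2 ∈ E ∩ Ico (s + q.1) (s + q.1 + h)}
      = (Prod.snd ⁻¹' E) ∩ ({q : ℝ × ℝ | s + q.1 ≤ q.2} ∩ {q : ℝ × ℝ | q.2 < s + q.1 + h}) := by
      ext q; simp
    rw [e]
    exact (measurable_snd hE).inter ((measurableSet_le (by fun_prop) (by fun_prop)).inter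
      (measurableSet_lt (by fun_prop) (by fun_prop)))
  have hfub : ∀ s : ℝ, ∫⁻ y, volume (E ∩ Ico (s + y) (s + y + h)) = ENNReal.ofReal h * volume E := by
    intro s
    have a1 := Measure.prod_apply (μ := (volume : Measure ℝ)) (ν := (volume : Measure ℝ)) (hmeas s)
    have a2 := Measure.prod_apply_symm (μ := (volume : Measure ℝ)) (ν := (volume : Measure ℝ)) (hmeas s)
    have e1 : ∀ y : ℝ, Prod.mk y ⁻¹' {q : ℝ × ℝ | q.2 ∈ E ∩ Ico (s + q.1) (s + q.1 + h)}
       = E ∩ Ico (s + y) (s + y + h) := by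
      intro y; ext z; rfl
    simp only [e1] at a1
    rw [← a1, a2, ← setLIntegral_const, ← lintegral_indicator hE]
    congr 1
    ext z
    by_cases hz : z ∈ E
    · rw [indicator_of_mem hz]
      have : (fun x : ℝ => (x, z)) ⁻¹' {q : ℝ × ℝ | q.2 ∈ E ∩ Ico (s + q.1) (s + q.1 + h)}
         = Ioc (z - s - h) (z - s) := by
        ext y
        simp only [mem_preimage, mem_ofPred_eq, mem_inter_iff, hz, true_and, mem_Ico, mem_Ioc]
        constructor <;> rintro ⟨_, _⟩ <;> constructor <;> linarith
      rw [this, Real.volume_Ioc]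
      congr 1; ring
    · rw [indicator_of_notMem hz]
      have : (fun x : ℝ => (x, z)) ⁻¹' {q : ℝ × ℝ | q.2 ∈ E ∩ Ico (s + q.1) (s + q.1 + h)} = ∅ := by
        ext y
        simp [hz]
      rw [this, measure_empty]
  have hmf : ∀ s : ℝ, Measurable fun y => volume (E ∩ Ico (s + y) (s + y + h)) := by
    intro s
    exact measurable_measure_prodMk_left (hmeas s)
  have htot : ∫⁻ y, volume (E ∩ ((F : Set ℝ) + Ico y (y + h)))
      = F.card * (ENNReal.ofReal h * volume E) := by
    simp only [hsum]
    rw [lintegral_finsetSum _ fun s _ => hmf s]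
    simp [hfub]
  have hsupp : ∫⁻ y, volume (E ∩ ((F : Set ℝ) + Ico y (y + h)))
      = ∫⁻ y in Icc (-R-1) (R+1), volume (E ∩ ((F : Set ℝ) + Ico y (y + h))) := by
    rw [← lintegral_indicator measurableSet_Icc]
    congr 1
    ext y
    by_cases hy : y ∈ Icc (-R-1) (R+1)
    · rw [indicator_of_mem hy]
    · rw [indicator_of_notMem hy, hG]
      convert measure_empty (μ := (volume : Measure ℝ))
      rw [← Set.disjoint_iff_inter_eq_empty, Set.disjoint_left]
      intro z hz hz'
      simp only [mem_iUnion, mem_Ico, exists_prop] at hz'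
      obtain ⟨s, hs, hz1, hz2⟩ := hz'
      have := hE1 hz
      have := hF s hs
      simp only [mem_Icc] at *
      apply hy
      constructor <;> linarith
  have hI : volume (Icc (-R-1) (R+1)) = ENNReal.ofReal (2 * R + 2) := by
    rw [Real.volume_Icc]; congr 1; ring
  have hI0 : volume (Icc (-R-1) (R+1)) ≠ 0 := by
    rw [hI]; simp; linarith
  obtain ⟨y, -, hy⟩ := exists_setLAverage_le (μ := volume) hI0 measurableSet_Icc.nullMeasurableSet
    (f := fun y => volume (E ∩ ((F : Set ℝ) + Ico y (y + h))))
    (by rw [← hsupp, htot]; exact ENNReal.mul_ne_top (by simp) (ENNReal.mul_ne_top (by simp) hEfin))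
  refine ⟨y, hGm y, ?_⟩
  rw [setLAverage_eq, ← hsupp, htot, hI] at hy
  have hy' := ENNReal.toReal_mono (measure_ne_top_of_subset inter_subset_left hEfin) hy
  rw [ENNReal.toReal_div, ENNReal.toReal_mul, ENNReal.toReal_mul, ENNReal.toReal_ofReal hh.le,
    ENNReal.toReal_ofReal (by linarith), ENNReal.toReal_natCast] at hy'
  have := measureReal_inter_add_sdiff (μ := volume) (s := E) (hGm y) hEfin
  have e : (F.card : ℝ) * (h * (volume E).toReal) / (2 * R + 2)
     = F.card * h / (2 * R + 2) * volume.real E := by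
    rw [measureReal_def]; ring
  rw [e] at hy'
  change _ ≤ volume.real _ at hy'
  linarith

lemma core_cover (S : Set ℝ) (hS : S.Infinite) (R : ℝ) (hR : 0 < R) (hSR : S ⊆ Icc (-R) R)
    (ε : ℝ) (hε : 0 < ε) :
    ∃ A : Set ℝ, volume A ≤ ENNReal.ofReal ε ∧ Icc 0 1 ⊆ S + A := by
  obtain ⟨k, hk⟩ : ∃ k : ℕ, Real.exp (-(k * (ε / 4) / (2 * R + 2))) ≤ ε / 2 := by
    obtain ⟨k, hk⟩ := exists_nat_gt (-Real.log (ε / 2) * (2 * R + 2) / (ε / 4))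
    refine ⟨k, ?_⟩
    rw [← Real.le_log_iff_exp_le (by linarith)]
    rw [div_lt_iff₀ (by linarith), ← lt_div_iff₀ (by linarith)] at hk
    linarith
  obtain ⟨F, hFS, hFk⟩ := hS.exists_subset_card_eq k
  have hsep : ∃ h0 : ℝ, 0 < h0 ∧ ∀ s ∈ F, ∀ t ∈ F, s < t → s + h0 ≤ t := by
    have : ∀ᶠ h0 in nhdsWithin (0:ℝ) (Ioi 0), ∀ s ∈ F, ∀ t ∈ F, s < t → s + h0 ≤ t := by
      rw [Filter.eventually_all_finset]
      intro s hs
      rw [Filter.eventually_all_finset]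
      intro t ht
      by_cases hst : s < t
      · filter_upwards [Ioo_mem_nhdsGT (sub_pos.2 hst)] with h0 hh0 _
        linarith [hh0.2]
      · exact Filter.Eventually.of_forall fun _ h => absurd h hst
    obtain ⟨h0, hh, hh'⟩ := (this.and self_mem_nhdsWithin).exists
    exact ⟨h0, hh', hh⟩
  obtain ⟨h0, hh0, hsep⟩ := hsep
  obtain ⟨h, hh, hh1, hhε, hhh⟩ : ∃ h : ℝ, 0 < h ∧ h ≤ 1 ∧ h ≤ ε / 4 ∧ h ≤ h0 :=
    ⟨min 1 (min (ε / 4) h0), by positivity, by simp, by simp, by simp⟩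
  have ind : ∀ n : ℕ, ∃ A E : Set ℝ, volume A ≤ ENNReal.ofReal (n * h) ∧ MeasurableSet E ∧
      E ⊆ Icc 0 1 ∧ Icc 0 1 \ E ⊆ S + A ∧
      volume.real E ≤ Real.exp (-(k * (n * h) / (2 * R + 2))) := by
    intro n
    induction n with
    | zero => exact ⟨∅, Icc 0 1, by simp, measurableSet_Icc, subset_rfl, by simp, by simp⟩
    | succ n ih =>
      obtain ⟨A, E, hA, hEm, hE1, hcov, hE⟩ := ih
      obtain ⟨y, hym, hy⟩ := step_cover F R h hR hh hh1 (fun s hs => hSR (hFS hs))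
        (fun s hs t ht hst => by linarith [hsep s hs t ht hst]) E hEm hE1
      refine ⟨A ∪ Ico y (y + h), E \ ((F : Set ℝ) + Ico y (y + h)), ?_, hEm.diff hym,
        sdiff_subset.trans hE1, ?_, ?_⟩
      · refine (measure_union_le _ _).trans ?_
        rw [Real.volume_Ico]
        have : ((n + 1 : ℕ) : ℝ) * h = n * h + (y + h - y) := by push_cast; ring
        rw [this, ENNReal.ofReal_add (by positivity) (by linarith)]
        gcongr
      · rintro x ⟨hx, hxE⟩
        rw [add_union]
        by_cases hxE' : x ∈ E
        · right
          by_contra hcon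
          exact hxE ⟨hxE', fun hh => hcon (add_subset_add_right hFS hh)⟩
        · left; exact hcov ⟨hx, hxE'⟩
      · rw [hFk] at hy
        refine hy.trans ?_
        have e : -((k:ℝ) * (((n + 1 : ℕ) : ℝ) * h) / (2 * R + 2))
          = -(k * h / (2 * R + 2)) + -(k * (n * h) / (2 * R + 2)) := by push_cast; ring
        rw [e, Real.exp_add]
        have := Real.add_one_le_exp (-(k * h / (2 * R + 2)))
        apply mul_le_mul _ hE measureReal_nonneg (Real.exp_pos _).le
        linarith
  obtain ⟨A, E, hA, hEm, hE1, hcov, hE⟩ := ind ⌊ε / 2 / h⌋₊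
  obtain ⟨s, hs⟩ := hS.nonempty
  have n1 : (⌊ε / 2 / h⌋₊ : ℝ) * h ≤ ε / 2 := by
    rw [← le_div_iff₀ hh]; exact Nat.floor_le (by positivity)
  have n2 : ε / 4 ≤ (⌊ε / 2 / h⌋₊ : ℝ) * h := by
    have := Nat.lt_floor_add_one (ε / 2 / h)
    rw [div_lt_iff₀ hh] at this
    linarith
  have hEfin : volume E ≠ ⊤ := ((measure_mono hE1).trans_lt (by simp)).ne
  refine ⟨A ∪ ((-s) +ᵥ E), ?_, ?_⟩
  · refine (measure_union_le _ _).trans ?_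
    rw [measure_vadd, show ε = ε / 2 + ε / 2 by ring, ENNReal.ofReal_add (by positivity) (by positivity)]
    refine add_le_add (hA.trans (ENNReal.ofReal_le_ofReal n1)) ?_
    rw [← ofReal_measureReal hEfin]
    apply ENNReal.ofReal_le_ofReal
    refine hE.trans (le_trans ?_ hk)
    gcongr
  · intro x hx
    rw [add_union]
    by_cases hxE : x ∈ E
    · right
      exact ⟨s, hs, -s + x, ⟨x, hxE, rfl⟩, by simp⟩
    · left; exact hcov ⟨hx, hxE⟩

lemma stage_cover (C : Set ℝ) (hC : IsCompact C) (hacc : Preperfect C) (η ε : ℝ) (hη : 0 < η)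
    (hε : 0 < ε) :
    ∃ (T : Set ℝ) (δ : ℝ), IsClosed T ∧ volume T ≤ ENNReal.ofReal ε ∧ 0 < δ ∧ δ ≤ η ∧
      ∀ p ∈ C, ∀ x ∈ Icc (0:ℝ) 1, ∃ p' ∈ C, dist p' p ≤ η ∧
        Metric.closedBall (x - p') δ ⊆ T := by
  obtain ⟨R, hR, hCR⟩ : ∃ R : ℝ, 0 < R ∧ C ⊆ Icc (-R) R := by
    obtain ⟨R, hR, h⟩ := hC.isBounded.subset_closedBall_lt 0 0
    refine ⟨R, hR, ?_⟩
    rw [Real.closedBall_eq_Icc] at h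
    simpa using h
  obtain ⟨t, htC, htfin, hcov⟩ := hC.finite_cover_balls (half_pos hη)
  have hinf : ∀ c ∈ C, (C ∩ Metric.ball c (η / 2)).Infinite := by
    intro c hc
    have := (hacc c hc)
    rw [accPt_iff_frequently] at this
    intro hfin
    have hfin' : ((C ∩ Metric.ball c (η / 2)) \ {c}).Finite := hfin.subset sdiff_subset
    have h2 := hfin'.isClosed.isOpen_compl.mem_nhds (x := c) (by simp)
    obtain ⟨y, ⟨hy1, hy2⟩, hy3, hy4⟩ :=
      (this.and_eventually (Filter.inter_mem h2 (Metric.ball_mem_nhds c (half_pos hη)))).exists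
    exact hy3 ⟨⟨hy2, hy4⟩, hy1⟩
  have hn : (0:ℝ) < ε / (2 * (htfin.toFinset.card + 1)) := by positivity
  have hA : ∀ c : ℝ, ∃ A : Set ℝ, volume A ≤ ENNReal.ofReal (ε / (2 * (htfin.toFinset.card + 1))) ∧
      (c ∈ C → Icc 0 1 ⊆ (C ∩ Metric.ball c (η / 2)) + A) := by
    intro c
    by_cases hc : c ∈ C
    · obtain ⟨A, h1, h2⟩ := core_cover _ (hinf c hc) R hR (inter_subset_left.trans hCR) _ hn
      exact ⟨A, h1, fun _ => h2⟩
    · exact ⟨∅, by simp, fun h => absurd h hc⟩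
  choose A hAv hAc using hA
  have hvol : volume (⋃ c ∈ htfin.toFinset, A c) < ENNReal.ofReal ε := by
    refine (measure_biUnion_finset_le _ _).trans_lt ?_
    refine (Finset.sum_le_sum fun c _ => hAv c).trans_lt ?_
    rw [Finset.sum_const, nsmul_eq_mul, ← ENNReal.ofReal_natCast,
      ← ENNReal.ofReal_mul (by positivity)]
    rw [ENNReal.ofReal_lt_ofReal_iff hε, mul_div_assoc', div_lt_iff₀ (by positivity)]
    nlinarith [(Nat.cast_nonneg htfin.toFinset.card : (0:ℝ) ≤ _)]
  obtain ⟨U, hAU, hUo, hUv⟩ := Set.exists_isOpen_lt_of_lt _ _ hvol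
  have hev : ∀ᶠ δ in nhdsWithin (0:ℝ) (Ioi 0), ∀ c ∈ t, ∀ x ∈ Icc (0:ℝ) 1,
      ∃ s ∈ C ∩ Metric.ball c (η / 2), Metric.ball (x - s) δ ⊆ U := by
    rw [Filter.eventually_all_finite htfin]
    intro c hc
    obtain ⟨δ, hδ, hδ'⟩ := lebesgue_number_lemma_of_metric (s := Icc (0:ℝ) 1)
      (c := fun s : ↥(C ∩ Metric.ball c (η / 2)) => (fun y => y - (s : ℝ)) ⁻¹' U) isCompact_Icc
      (fun s => hUo.preimage (by fun_prop)) (by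
        intro x hx
        obtain ⟨s, hs, a, ha, rfl⟩ := hAc c (htC hc) hx
        refine mem_iUnion.2 ⟨⟨s, hs⟩, ?_⟩
        simp only [mem_preimage, add_sub_cancel_left]
        exact hAU (mem_biUnion (by simpa using hc) ha))
    filter_upwards [Ioo_mem_nhdsGT hδ] with d hd x hx
    obtain ⟨⟨s, hs⟩, hsub⟩ := hδ' x hx
    refine ⟨s, hs, fun z hz => ?_⟩
    have : z + s ∈ Metric.ball x δ := by
      rw [Metric.mem_ball, Real.dist_eq] at *
      have e : z + s - x = z - (x - s) := by ring
      rw [e]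
      exact hz.trans hd.2
    simpa using hsub this
  obtain ⟨δ, hδ, hδ0, hδη⟩ := (hev.and (Ioo_mem_nhdsGT hη)).exists
  refine ⟨{y | ∀ z ∈ Uᶜ, δ / 2 ≤ dist z y}, δ / 2, ?_, ?_, by positivity, by linarith, ?_⟩
  · have : {y | ∀ z ∈ Uᶜ, δ / 2 ≤ dist z y} = ⋂ z ∈ Uᶜ, {y | δ / 2 ≤ dist z y} := by
      ext y; simp
    rw [this]
    exact isClosed_biInter fun z _ => isClosed_le (by fun_prop) (by fun_prop)
  · refine (measure_mono ?_).trans hUv.le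
    intro y hy
    by_contra hyU
    have := hy y hyU
    rw [dist_self] at this
    linarith
  · intro p hp x hx
    obtain ⟨c, hc, hpc⟩ := mem_iUnion₂.1 (hcov hp)
    obtain ⟨s, ⟨hsC, hsc⟩, hs⟩ := hδ c hc x hx
    refine ⟨s, hsC, ?_, ?_⟩
    · rw [Metric.mem_ball] at *
      have := dist_triangle_right s p c
      linarith
    · intro w hw z hz
      rw [Metric.mem_closedBall] at hw
      have h1 : δ ≤ dist z (x - s) := by
        by_contra hcon
        exact hz (hs (Metric.mem_ball.2 (not_le.1 hcon)))
      have := dist_triangle z w (x - s)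
      linarith

lemma closed_null (C : Set ℝ) (hC : IsCompact C) (hacc : Preperfect C) (hne : C.Nonempty) :
    ∃ M : Set ℝ, IsClosed M ∧ volume M = 0 ∧ Icc 0 1 ⊆ C + M := by
  have key := fun (n : ℕ) (η : {r : ℝ // 0 < r}) =>
    stage_cover C hC hacc (η / 2) (1 / (n + 1)) (half_pos η.2) (by positivity)
  choose T δ hTc hTv hδ0 hδη hT using key
  let d : ℕ → {r : ℝ // 0 < r} := fun n => Nat.rec ⟨1, one_pos⟩ (fun n r => ⟨δ n r, hδ0 n r⟩) n
  have hd : ∀ n, (d (n + 1) : ℝ) = δ n (d n) := fun n => rfl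
  refine ⟨⋂ n, T n (d n), isClosed_iInter fun n => hTc _ _, ?_, ?_⟩
  · apply le_antisymm _ bot_le
    have : Filter.Tendsto (fun n : ℕ => ENNReal.ofReal (1 / ((n:ℝ) + 1))) Filter.atTop (nhds 0) := by
      rw [← ENNReal.ofReal_zero]
      exact ENNReal.tendsto_ofReal tendsto_one_div_add_atTop_nhds_zero_nat
    exact ge_of_tendsto' this fun n => (measure_mono (iInter_subset _ n)).trans (hTv n _)
  · intro x hx
    obtain ⟨p0, hp0⟩ := hne
    have hT' := fun (n : ℕ) (p : C) => hT n (d n) p p.2 x hx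
    choose q hqC hq1 hq2 using hT'
    let p : ℕ → C := fun n => Nat.rec ⟨p0, hp0⟩ (fun n r => ⟨q n r, hqC n r⟩) n
    have hp : ∀ n, (p (n + 1) : ℝ) = q n (p n) := fun n => rfl
    have hmono : ∀ n : ℕ, C ∩ Metric.closedBall (p (n + 1)).1 (d (n + 1)).1 ⊆
        C ∩ Metric.closedBall (p n).1 (d n).1 := by
      rintro n z ⟨hz, hz'⟩
      refine ⟨hz, ?_⟩
      rw [Metric.mem_closedBall] at *
      have h1 := hq1 n (p n)
      have h2 := hδη n (d n)
      rw [← hp] at h1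
      rw [← hd] at h2
      have := dist_triangle z (p (n + 1)).1 (p n).1
      linarith
    obtain ⟨y, hy⟩ := IsCompact.nonempty_iInter_of_sequence_nonempty_isCompact_isClosed
      (fun n : ℕ => C ∩ Metric.closedBall (p n).1 (d n).1) hmono
      (fun n => ⟨(p n).1, (p n).2, Metric.mem_closedBall_self (d n).2.le⟩)
      (hC.inter_right Metric.isClosed_closedBall)
      (fun n => hC.isClosed.inter Metric.isClosed_closedBall)
    rw [mem_iInter] at hy
    refine ⟨y, (hy 0).1, x - y, mem_iInter.2 fun n => ?_, by simp⟩
    apply hq2 n (p n)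
    have := (hy (n + 1)).2
    rw [Metric.mem_closedBall, hd, hp] at this
    rw [Metric.mem_closedBall, dist_sub_left]
    exact this

lemma exists_null_perfect (P : Set ℝ) (hP : Perfect P) (hne : P.Nonempty) :
    ∃ C ⊆ P, IsCompact C ∧ Perfect C ∧ C.Nonempty ∧ volume C = 0 := by
  obtain ⟨f, hfP, hfc, hfi⟩ := hP.exists_nat_bool_injection hne
  let g : (ℕ → Bool) → (ℕ → Bool) → (ℕ → Bool) :=
    fun a b n => if n % 2 = 0 then a (n / 2) else b (n / 2)
  have hga : ∀ a b a' b', g a b = g a' b' → a = a' := by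
    intro a b a' b' h
    ext n
    have := congrFun h (2 * n)
    simpa [g] using this
  have hgb : ∀ a b a' b', g a b = g a' b' → b = b' := by
    intro a b a' b' h
    ext n
    have := congrFun h (2 * n + 1)
    have e : (2 * n + 1) / 2 = n := by omega
    simpa [g, e] using this
  have hgc : ∀ a, Continuous (g a) := by
    intro a
    refine continuous_pi fun n => ?_
    by_cases hn : n % 2 = 0
    · simp only [g, hn, if_true]; fun_prop
    · simp only [g, hn, if_false]; fun_prop
  have hunc : ¬ (univ : Set (ℕ → Bool)).Countable := by
    rw [← Cardinal.le_aleph0_iff_set_countable, not_le, Cardinal.mk_univ]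
    simpa using Cardinal.cantor Cardinal.aleph0
  have hK : ∀ a, IsCompact (range fun b => f (g a b)) := fun a =>
    isCompact_range (hfc.comp (hgc a))
  have hcnt := Measure.countable_meas_pos_of_disjoint_iUnion (μ := (volume : Measure ℝ))
    (As := fun a => range fun b => f (g a b)) (fun a => (hK a).measurableSet) (by
      intro a a' haa
      rw [Function.onFun, Set.disjoint_left]
      rintro _ ⟨b, rfl⟩ ⟨b', hb'⟩
      exact haa (hga _ _ _ _ (hfi hb')).symm)
  obtain ⟨a, ha⟩ : ∃ a, volume (range fun b => f (g a b)) = 0 := by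
    by_contra! hcon
    apply hunc
    convert hcnt
    ext a
    simp [pos_iff_ne_zero, hcon a]
  obtain ⟨D, hD, hDne, hDs⟩ := exists_perfect_nonempty_of_isClosed_of_not_countable (hK a).isClosed
    (by
      intro h
      apply hunc
      rw [← image_univ] at h
      exact countable_of_injective_of_countable_image
        (fun b _ b' _ hb => hgb _ _ _ _ (hfi hb)) h)
  refine ⟨D, hDs.trans ?_, (hK a).of_isClosed_subset hD.closed hDs, hD, hDne,
    measure_mono_null hDs ha⟩
  rintro _ ⟨b, rfl⟩
  exact hfP ⟨_, rfl⟩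

lemma null_add (V N : Set ℝ) (hV : V.Countable) (hN : volume N = 0) : volume (V + N) = 0 := by
  rw [← iUnion_add_left_image, measure_biUnion_null_iff hV]
  intro s _
  have := measure_vadd (volume : Measure ℝ) s N
  rw [hN] at this
  exact this

/-- The Erdős–Kunen–Mauldin theorem: for every nonempty perfect set `P ⊆ ℝ`
there is a nonempty perfect set `M` of Lebesgue measure zero with
`P + M = ℝ`. -/
theorem erdos_kunen_mauldin (P : Set ℝ) (hP : Perfect P) (hne : P.Nonempty) :
    ∃ M : Set ℝ, Perfect M ∧ M.Nonempty ∧ MeasureTheory.volume M = 0 ∧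
      P + M = Set.univ := by
  obtain ⟨C, hCP, hCc, hCp, hCne, hC0⟩ := exists_null_perfect P hP hne
  obtain ⟨M₀, hM₀, hM₀v, hM₀c⟩ := closed_null C hCc hCp.acc hCne
  have hK : IsCompact (M₀ ∩ (Icc 0 1 - C)) := by
    rw [sub_eq_add_neg]
    exact (isCompact_Icc.add hCc.neg).inter_left hM₀
  have hM : IsClosed (range ((↑) : ℤ → ℝ) + M₀ ∩ (Icc 0 1 - C)) :=
    Int.isClosedEmbedding_coe_real.isClosed_range.add_right_of_isCompact hK
  have hM0 : volume (range ((↑) : ℤ → ℝ) + M₀ ∩ (Icc 0 1 - C)) = 0 :=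
    null_add _ _ (countable_range _) (measure_mono_null inter_subset_left hM₀v)
  have hcov : C + (range ((↑) : ℤ → ℝ) + M₀ ∩ (Icc 0 1 - C)) = univ := by
    rw [eq_univ_iff_forall]
    intro x
    have hx : Int.fract x ∈ Icc (0:ℝ) 1 := ⟨Int.fract_nonneg x, (Int.fract_lt_one x).le⟩
    obtain ⟨c, hc, m, hm, hcm⟩ := hM₀c hx
    have hcm' : c + m = Int.fract x := hcm
    refine ⟨c, hc, ⌊x⌋ + m, ⟨⌊x⌋, ⟨⌊x⌋, rfl⟩, m, ⟨hm, _, hx, c, hc, ?_⟩, rfl⟩, ?_⟩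
    · change Int.fract x - c = m
      linarith
    · change c + (⌊x⌋ + m) = x
      have := Int.floor_add_fract x
      linarith
  obtain ⟨V, D, hV, hD, hVD⟩ := exists_countable_union_perfect_of_isClosed hM
  have hCV : volume (C + V) = 0 := by
    rw [add_comm]
    exact null_add V C hV hC0
  have hCD : C + D = univ := by
    have hcl : IsClosed (C + D) := hD.closed.add_left_of_isCompact hCc
    rw [hVD, add_union] at hcov
    rw [← compl_empty_iff, ← hcl.isOpen_compl.measure_eq_zero_iff volume]
    refine measure_mono_null ?_ hCV
    rw [compl_subset_iff_union, union_comm]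
    exact hcov
  refine ⟨D, hD, ?_, measure_mono_null (hVD ▸ subset_union_right) hM0, ?_⟩
  · have : (C + D).Nonempty := by rw [hCD]; exact univ_nonempty
    exact this.of_add_right
  · rw [eq_univ_iff_forall]
    intro x
    exact add_subset_add_right hCP (hCD ▸ mem_univ x)
end

section
/- For every nonempty perfect set P ⊆ ℝ there exists a nonempty perfect Dirichlet set M ⊆ ℝ such that P + M = ℝ, where P + M = {p + m : p ∈ P, m ∈ M}. -/
open scoped Pointwise

/-- The distance from a real number to the nearest integer. -/
noncomputable def distNearestInt (t : ℝ) : ℝ := |t - round t|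

/-- A Dirichlet set: there is a strictly increasing sequence of positive
integers `n k` such that `sup_{x ∈ D} ‖n k * x‖ → 0`, where `‖·‖` is the
distance to the nearest integer. -/
def IsDirichletSet (D : Set ℝ) : Prop :=
  ∃ n : ℕ → ℕ, StrictMono n ∧ (∀ k, 0 < n k) ∧
    ∀ ε : ℝ, 0 < ε → ∃ K : ℕ, ∀ k ≥ K, ∀ x ∈ D,
      distNearestInt ((n k : ℝ) * x) < ε

/-- Distance to the nearest integer is the norm on the unit circle. -/
lemma distNearestInt_eq_norm (t : ℝ) : distNearestInt t = ‖(t : UnitAddCircle)‖ := by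
  rw [UnitAddCircle.norm_eq]; rfl

lemma norm_le_of_near (t : ℝ) (z : ℤ) (e : ℝ) (h : |t - z| ≤ e) :
    ‖(t : UnitAddCircle)‖ ≤ e := by
  rw [UnitAddCircle.norm_eq]
  exact (round_le t z).trans h

lemma exists_near {P : Set ℝ} (hP : Preperfect P) {p : ℝ} (hp : p ∈ P) {d : ℝ} (hd : 0 < d) :
    ∃ q ∈ P, q ≠ p ∧ |q - p| < d := by
  have h := (preperfect_iff_nhds.mp hP) p hp (Metric.ball p d) (Metric.ball_mem_nhds p hd)
  obtain ⟨y, ⟨hy1, hy2⟩, hne⟩ := h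
  exact ⟨y, hy2, hne, by simpa [Real.dist_eq] using hy1⟩

/-- Multiples of a small nonzero number hit every target modulo one. -/
lemma exists_mult (d : ℝ) (hd : d ≠ 0) (u : ℝ) :
    ∃ a : ℕ, (a : ℝ) ≤ 1 / |d| ∧ ∃ z : ℤ, |a * d - u - z| ≤ |d| := by
  have key : ∀ d : ℝ, 0 < d → ∀ u : ℝ,
      ∃ a : ℕ, (a : ℝ) ≤ 1 / d ∧ ∃ z : ℤ, |a * d - u - z| ≤ d := by
    intro d hd u
    have h0 : 0 ≤ Int.fract u / d := div_nonneg (Int.fract_nonneg u) hd.le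
    have h1 := Nat.floor_le h0
    have h2 := Nat.lt_floor_add_one (Int.fract u / d)
    refine ⟨⌊Int.fract u / d⌋₊, h1.trans ?_, -⌊u⌋, ?_⟩
    · gcongr
      exact (Int.fract_lt_one u).le
    · rw [le_div_iff₀ hd] at h1
      rw [div_lt_iff₀ hd] at h2
      have h3 := Int.floor_add_fract u
      push_cast
      rw [abs_le]
      constructor <;> nlinarith
  rcases lt_or_gt_of_ne hd with h | h
  · obtain ⟨a, ha, z, hz⟩ := key (-d) (by linarith) (-u)
    rw [abs_of_neg h]
    refine ⟨a, ha, -z, ?_⟩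
    rw [← abs_neg]
    convert hz using 2
    push_cast
    ring
  · rw [abs_of_pos h]
    exact key d h u

/-- Simultaneous approximation with lacunary perturbations. -/
lemma lacunary {P : Set ℝ} (hP : Preperfect P) {ι : Type*} [DecidableEq ι] (p t : ι → ℝ)
    (s : Finset ι) (hs : ∀ j ∈ s, p j ∈ P) :
    ∀ (e d : ℝ) (n0 : ℕ), 0 < e → 0 < d → ∃ n : ℕ, n0 ≤ n ∧ ∃ q : ι → ℝ, ∀ j ∈ s,
      q j ∈ P ∧ |q j - p j| ≤ d ∧ ∃ z : ℤ, |n * (q j - p j) - t j - z| ≤ e := by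
  induction s using Finset.induction_on with
  | empty => intro e d n0 _ _; exact ⟨n0, le_rfl, p, by simp⟩
  | insert i s hi ih =>
    intro e d n0 he hd
    obtain ⟨y, hyP, hyne, hy⟩ := exists_near hP (hs i (by simp)) (lt_min he hd)
    have hne : y - p i ≠ 0 := sub_ne_zero.mpr hyne
    have hpos : 0 < |y - p i| := abs_pos.mpr hne
    obtain ⟨n, hn, q, hq⟩ := ih (fun j hj => hs j (by simp [hj])) (e / 2)
      (min d (e / 2 * |y - p i|)) n0 (by positivity) (lt_min hd (by positivity))
    obtain ⟨a, ha, z, hz⟩ := exists_mult (y - p i) hne (t i - n * (y - p i))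
    refine ⟨n + a, by omega, Function.update q i y, ?_⟩
    intro j hj
    rcases Finset.mem_insert.mp hj with rfl | hjs
    · simp only [Function.update_self]
      refine ⟨hyP, (hy.trans_le (min_le_right _ _)).le, z, ?_⟩
      have : ((n + a : ℕ) : ℝ) * (y - p j) - t j - z
          = a * (y - p j) - (t j - n * (y - p j)) - z := by push_cast; ring
      rw [this]
      exact hz.trans (hy.trans_le (min_le_left _ _)).le
    · have hji : j ≠ i := fun h => hi (h ▸ hjs)
      simp only [Function.update_of_ne hji]
      obtain ⟨h1, h2, w, hw⟩ := hq j hjs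
      refine ⟨h1, h2.trans (min_le_left _ _), w, ?_⟩
      have h3 : |(a : ℝ) * (q j - p j)| ≤ e / 2 := by
        rw [abs_mul, Nat.abs_cast]
        calc (a : ℝ) * |q j - p j| ≤ (1 / |y - p i|) * (e / 2 * |y - p i|) := by
              gcongr
              exact h2.trans (min_le_right _ _)
          _ = e / 2 := by field_simp
      have : ((n + a : ℕ) : ℝ) * (q j - p j) - t j - w
          = (n * (q j - p j) - t j - w) + a * (q j - p j) := by push_cast; ring
      rw [this]
      exact (abs_add_le _ _).trans (by linarith)

lemma step {P : Set ℝ} (hP : Preperfect P) (F : Finset ℝ) (hF : ∀ p ∈ F, p ∈ P)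
    (r : ℝ) (hr : 0 < r) (n0 : ℕ) (e : ℝ) (he : 0 < e) :
    ∃ (n : ℕ) (F' : Finset ℝ) (r' : ℝ), n0 < n ∧ (∀ p ∈ F', p ∈ P) ∧ 0 < r' ∧ r' ≤ r / 2 ∧
      ∀ x : ℝ, ∀ p ∈ F, ∃ q ∈ F', |q - p| ≤ r / 2 ∧
        ∀ y, |y - q| ≤ r' → ‖((n * (x - y) : ℝ) : UnitAddCircle)‖ ≤ e := by
  classical
  obtain ⟨N, hN⟩ := exists_nat_gt (3 / e)
  have hN0 : (0 : ℝ) < N := lt_trans (by positivity) hN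
  have hNe : 1 / (N : ℝ) ≤ e / 3 := by
    rw [div_lt_iff₀ he] at hN
    rw [div_le_div_iff₀ hN0 (by norm_num)]
    linarith
  obtain ⟨n, hn, q, hq⟩ := lacunary hP (fun j : ℝ × ℕ => j.1) (fun j => (j.2 : ℝ) / N)
    (F ×ˢ Finset.range N) (fun j hj => hF _ (Finset.mem_product.mp hj).1) (e / 3) (r / 2) (n0 + 1)
    (by positivity) (by positivity)
  have hn0 : (0 : ℝ) < n := by exact_mod_cast (by omega : 0 < n)
  refine ⟨n, (F ×ˢ Finset.range N).image q, min (r / 2) (e / 3 / n), by omega, ?_,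
    lt_min (by positivity) (by positivity), min_le_left _ _, ?_⟩
  · intro p hp
    obtain ⟨j, hj, rfl⟩ := Finset.mem_image.mp hp
    exact (hq j hj).1
  · intro x p hp
    set u : ℝ := n * (x - p) with hu
    have f0 := Int.fract_nonneg u
    have f1 := Int.fract_lt_one u
    have h0 : 0 ≤ N * Int.fract u := by positivity
    have h1 := Nat.floor_le h0
    have h2 := Nat.lt_floor_add_one (N * Int.fract u)
    set i := ⌊N * Int.fract u⌋₊ with hi
    have hiN : i < N := by
      have : (i : ℝ) < N := by nlinarith
      exact_mod_cast this
    have hmem : (p, i) ∈ F ×ˢ Finset.range N := by simp [hp, hiN]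
    obtain ⟨_, hd, z, hz⟩ := hq (p, i) hmem
    refine ⟨q (p, i), Finset.mem_image_of_mem _ hmem, hd, ?_⟩
    intro y hy
    simp only at hd hz
    apply norm_le_of_near _ (⌊u⌋ - z)
    have a1 : |Int.fract u - i / N| ≤ e / 3 := by
      refine le_trans ?_ hNe
      have : Int.fract u - i / N = (N * Int.fract u - i) / N := by field_simp
      rw [this, abs_div, abs_of_pos hN0]
      gcongr
      rw [abs_le]; constructor <;> linarith
    have a2 : |(n : ℝ) * (y - q (p, i))| ≤ e / 3 := by
      rw [abs_mul, abs_of_pos hn0]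
      calc (n : ℝ) * |y - q (p, i)| ≤ n * (e / 3 / n) := by
            gcongr; exact hy.trans (min_le_right _ _)
        _ = e / 3 := by field_simp
    have h3 := Int.floor_add_fract u
    have : (n : ℝ) * (x - y) - ((⌊u⌋ - z : ℤ) : ℝ) = (Int.fract u - i / N)
        - (n * (q (p, i) - p) - i / N - z) - n * (y - q (p, i)) := by
      push_cast
      have : (n : ℝ) * (x - y) = u - n * (q (p, i) - p) - n * (y - q (p, i)) := by
        rw [hu]; ring
      rw [this]; linarith
    rw [this]
    rw [abs_le] at *
    constructor <;> linarith [a1.1, a1.2, a2.1, a2.2, hz.1, hz.2]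

/-- The set of reals that are `1/(k+1)`-close to integers after multiplication by `n k`. -/
def nearSet (n : ℕ → ℕ) (c : ℝ) : Set ℝ :=
  {m | ∀ k : ℕ, ‖((n k * m : ℝ) : UnitAddCircle)‖ ≤ c * (1 / ((k : ℝ) + 1))}

lemma isClosed_nearSet (n : ℕ → ℕ) (c : ℝ) : IsClosed (nearSet n c) := by
  unfold nearSet
  rw [Set.ofPred_forall]
  refine isClosed_iInter fun k => isClosed_le ?_ continuous_const
  exact ((AddCircle.continuous_mk' 1).comp (continuous_const.mul continuous_id)).norm

lemma main_construction {P : Set ℝ} (hP : Perfect P) (hne : P.Nonempty) :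
    ∃ n : ℕ → ℕ, StrictMono n ∧ (∀ k, 0 < n k) ∧
      ∀ x : ℝ, ∃ y ∈ P, x - y ∈ nearSet n 1 := by
  classical
  let S := {a : Finset ℝ × ℝ × ℕ // (∀ p ∈ a.1, p ∈ P) ∧ 0 < a.2.1}
  have hstep : ∀ (k : ℕ) (a : S), ∃ b : S, a.1.2.2 < b.1.2.2 ∧ b.1.2.1 ≤ a.1.2.1 / 2 ∧
      ∀ x : ℝ, ∀ p ∈ a.1.1, ∃ q ∈ b.1.1, |q - p| ≤ a.1.2.1 / 2 ∧
        ∀ y, |y - q| ≤ b.1.2.1 →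
          ‖((b.1.2.2 * (x - y) : ℝ) : UnitAddCircle)‖ ≤ 1 / ((k : ℝ) + 1) := by
    intro k a
    obtain ⟨n, F', r', h1, h2, h3, h4, h5⟩ := step hP.acc a.1.1 a.2.1 a.1.2.1 a.2.2 a.1.2.2
      (1 / ((k : ℝ) + 1)) (by positivity)
    exact ⟨⟨(F', r', n), h2, h3⟩, h1, h4, h5⟩
  choose nx hn1 hn2 hn3 using hstep
  obtain ⟨p0, hp0⟩ := hne
  let s0 : S := ⟨({p0}, 1, 0), by simpa using hp0, by norm_num⟩
  let s : ℕ → S := fun k => Nat.rec s0 (fun k a => nx k a) k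
  have hs : ∀ k, s (k + 1) = nx k (s k) := fun k => rfl
  have hmono : StrictMono fun k => (s k).1.2.2 :=
    strictMono_nat_of_lt_succ fun k => by rw [hs]; exact hn1 k (s k)
  refine ⟨fun k => (s (k + 1)).1.2.2, fun a b h => hmono (Nat.succ_lt_succ h), fun k => ?_, fun x => ?_⟩
  · exact lt_of_le_of_lt (Nat.zero_le _) (hmono (Nat.succ_pos k))
  · have hq : ∀ k, ∀ p : {p // p ∈ (s k).1.1}, ∃ q : {q // q ∈ (s (k + 1)).1.1},
        |q.1 - p.1| ≤ (s k).1.2.1 / 2 ∧ ∀ y, |y - q.1| ≤ (s (k + 1)).1.2.1 →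
          ‖(((s (k + 1)).1.2.2 * (x - y) : ℝ) : UnitAddCircle)‖ ≤ 1 / ((k : ℝ) + 1) := by
      intro k p
      obtain ⟨q, h1, h2, h3⟩ := hn3 k (s k) x p.1 p.2
      exact ⟨⟨q, h1⟩, h2, h3⟩
    choose g hg1 hg2 using hq
    let w : (k : ℕ) → {p // p ∈ (s k).1.1} :=
      fun k => Nat.rec (motive := fun k => {p // p ∈ (s k).1.1})
        ⟨p0, by show p0 ∈ ({p0} : Finset ℝ); simp⟩ (fun k a => g k a) k
    have hw : ∀ k, w (k + 1) = g k (w k) := fun k => rfl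
    have hr : ∀ k, (s (k + 1)).1.2.1 ≤ (s k).1.2.1 / 2 := fun k => by rw [hs]; exact hn2 k (s k)
    have hd : ∀ k, |(w (k + 1)).1 - (w k).1| ≤ (s k).1.2.1 / 2 := fun k => by
      rw [hw]; exact hg1 k (w k)
    have hb : ∀ k j, |(w (k + j)).1 - (w k).1| ≤ (s k).1.2.1 - (s (k + j)).1.2.1 := by
      intro k j
      induction j with
      | zero => simp
      | succ j ih =>
        have e1 := hd (k + j)
        have e2 := hr (k + j)
        have e3 := abs_sub_le (w (k + j + 1)).1 (w (k + j)).1 (w k).1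
        rw [← add_assoc]
        linarith
    have hr1 : ∀ k, (s k).1.2.1 ≤ (1 / 2) ^ k := by
      intro k
      induction k with
      | zero => simp [s, s0]
      | succ k ih => have := hr k; rw [pow_succ]; linarith
    have hb' : ∀ k m, k ≤ m → |(w m).1 - (w k).1| ≤ (s k).1.2.1 := by
      intro k m h
      obtain ⟨j, rfl⟩ := Nat.exists_eq_add_of_le h
      have := hb k j
      have := (s (k + j)).2.2
      linarith
    have hc : CauchySeq fun k => (w k).1 := by
      apply cauchySeq_of_le_tendsto_0' (fun k : ℕ => ((1 : ℝ) / 2) ^ k)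
      · intro k m h
        rw [dist_comm, Real.dist_eq]
        exact (hb' k m h).trans (hr1 k)
      · exact tendsto_pow_atTop_nhds_zero_of_lt_one (by norm_num) (by norm_num)
    obtain ⟨y, hy⟩ := cauchySeq_tendsto_of_complete hc
    have hyk : ∀ k, |y - (w k).1| ≤ (s k).1.2.1 := by
      intro k
      refine le_of_tendsto ((hy.sub_const _).abs) ?_
      filter_upwards [Filter.eventually_ge_atTop k] with m hm using hb' k m hm
    refine ⟨y, hP.closed.mem_of_tendsto hy
      (Filter.Eventually.of_forall fun k => (s k).2.1 _ (w k).2), ?_⟩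
    intro k
    rw [one_mul]
    refine hg2 k (w k) y ?_
    rw [← hw]
    exact hyk (k + 1)

/-- A nonempty perfect set of reals contains one that has empty interior. -/
lemma exists_thin {P : Set ℝ} (hP : Perfect P) (hne : P.Nonempty) :
    ∃ D : Set ℝ, Perfect D ∧ D.Nonempty ∧ D ⊆ P ∧ interior D = ∅ := by
  obtain ⟨f, hf1, hf2, hf3⟩ := hP.exists_nat_bool_injection hne
  have hemb : Topology.IsEmbedding f := (hf2.isClosedEmbedding hf3).isEmbedding
  have hcl : IsClosed (Set.range f) := (hf2.isClosedEmbedding hf3).isClosed_range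
  have hnc : ¬ (Set.range f).Countable := by
    intro h
    have h1 : Countable (ℕ → Bool) := by
      have := h.to_subtype
      exact (Set.rangeFactorization_injective.mpr hf3).countable
    have h2 := Cardinal.mk_le_aleph0_iff.mpr h1
    rw [Cardinal.mk_pi, Cardinal.prod_const] at h2
    simp only [Cardinal.mk_bool, Cardinal.mk_nat, Cardinal.lift_id] at h2
    exact absurd h2 (not_le.mpr (Cardinal.cantor _))
  obtain ⟨D, hD, hDne, hDs⟩ := exists_perfect_nonempty_of_isClosed_of_not_countable hcl hnc
  refine ⟨D, hD, hDne, hDs.trans hf1, ?_⟩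
  have htd : IsTotallyDisconnected (Set.range f) := hemb.isTotallyDisconnected_range.mpr inferInstance
  by_contra hi
  obtain ⟨a, ha⟩ := Set.nonempty_iff_ne_empty.mpr hi
  obtain ⟨e, he, hball⟩ := Metric.isOpen_iff.mp isOpen_interior a ha
  have hsub : Metric.ball a e ⊆ Set.range f := hball.trans (interior_subset.trans hDs)
  have := htd _ hsub (convex_ball a e).isPreconnected (Metric.mem_ball_self he)
    (show a + e / 2 ∈ Metric.ball a e by
      rw [Metric.mem_ball, Real.dist_eq, add_sub_cancel_left, abs_of_pos] <;> linarith)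
  linarith

lemma not_countable_of_add {D M : Set ℝ} (hD : IsClosed D) (hi : interior D = ∅)
    (h : ∀ x : ℝ, ∃ y ∈ D, x - y ∈ M) : ¬ M.Countable := by
  intro hM
  have := hM.to_subtype
  obtain ⟨m, a, ha⟩ := nonempty_interior_of_iUnion_of_closed
    (f := fun m : M => Set.image (Homeomorph.addRight (m : ℝ)) D)
    (fun m => (Homeomorph.isClosed_image _).mpr hD) (by
      rw [Set.eq_univ_iff_forall]
      intro x
      obtain ⟨y, hy, hm⟩ := h x
      exact Set.mem_iUnion.mpr ⟨⟨_, hm⟩, y, hy, by simp⟩)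
  rw [← Homeomorph.image_interior, hi] at ha
  simp at ha

/-- Strengthening of the Erdős–Kunen–Mauldin theorem: for every nonempty
perfect set `P ⊆ ℝ` there is a nonempty perfect Dirichlet set `M` with
`P + M = ℝ`. -/
theorem perfect_add_dirichlet_eq_univ (P : Set ℝ) (hP : Perfect P)
    (hne : P.Nonempty) :
    ∃ M : Set ℝ, Perfect M ∧ M.Nonempty ∧ IsDirichletSet M ∧
      P + M = Set.univ := by
  obtain ⟨D, hD, hDne, hDP, hDi⟩ := exists_thin hP hne
  obtain ⟨n, hn, hn0, hx⟩ := main_construction hD hDne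
  obtain ⟨C, hC, ⟨c, hc⟩, hCs⟩ := exists_perfect_nonempty_of_isClosed_of_not_countable
    (isClosed_nearSet n 1) (not_countable_of_add hD.closed hDi hx)
  have hpre : Preperfect (nearSet n 1 + C) := by
    rw [preperfect_iff_nhds]
    rintro _ ⟨m, hm, b, hb, rfl⟩ U hU
    have hU' : Set.preimage (fun t => m + t) U ∈ nhds b :=
      (continuous_const.add continuous_id).continuousAt.preimage_mem_nhds hU
    obtain ⟨y, ⟨hy1, hy2⟩, hy3⟩ := preperfect_iff_nhds.mp hC.acc b hb _ hU'
    exact ⟨m + y, ⟨hy1, m, hm, y, hy2, rfl⟩, fun h => hy3 (add_left_cancel h)⟩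
  have hsub : closure (nearSet n 1 + C) ⊆ nearSet n 2 := by
    refine closure_minimal ?_ (isClosed_nearSet n 2)
    rintro _ ⟨m, hm, b, hb, rfl⟩ k
    have h1 := hm k
    have h2 := hCs hb k
    have h3 : ((n k * (m + b) : ℝ) : UnitAddCircle)
        = ((n k * m : ℝ) : UnitAddCircle) + ((n k * b : ℝ) : UnitAddCircle) := by
      rw [mul_add, AddCircle.coe_add]
    show ‖((n k * (m + b) : ℝ) : UnitAddCircle)‖ ≤ _
    rw [h3]
    exact (norm_add_le _ _).trans (by linarith)
  refine ⟨closure (nearSet n 1 + C), hpre.perfect_closure, ?_, ?_, ?_⟩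
  · exact ⟨c + c, subset_closure ⟨c, hCs hc, c, hc, rfl⟩⟩
  · refine ⟨n, hn, hn0, fun e he => ?_⟩
    obtain ⟨K, hK⟩ := exists_nat_gt (2 / e)
    refine ⟨K, fun k hk x hxm => ?_⟩
    rw [distNearestInt_eq_norm]
    refine (hsub hxm k).trans_lt ?_
    have hk' : (K : ℝ) ≤ k := by exact_mod_cast hk
    rw [div_lt_iff₀ he] at hK
    rw [mul_one_div, div_lt_iff₀ (by positivity)]
    nlinarith
  · rw [Set.eq_univ_iff_forall]
    intro x
    obtain ⟨y, hy, hm⟩ := hx (x - c)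
    exact ⟨y, hDP hy, (x - c - y) + c, subset_closure ⟨_, hm, c, hc, rfl⟩, by
      show y + (x - c - y + c) = x
      ring⟩
end

section
/- If (X_n) is an increasing sequence of sets of reals (X_n ⊆ X_{n+1} for all n) such that each X_n, with the subspace topology from ℝ, is a γ-set, then X = ⋃_n X_n is a γ-set. -/
/-- An ω-cover: an open cover not containing the whole space such that every
finite subset of the space is contained in some member. -/
def IsOmegaCover {X : Type*} [TopologicalSpace X] (U : Set (Set X)) : Prop :=
  (∀ u ∈ U, IsOpen u) ∧ ⋃₀ U = Set.univ ∧ Set.univ ∉ U ∧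
    ∀ F : Set X, F.Finite → ∃ u ∈ U, F ⊆ u

/-- A γ-cover: an infinite family of open sets such that every point belongs to
all but finitely many members. -/
def IsGammaCover {X : Type*} [TopologicalSpace X] (U : Set (Set X)) : Prop :=
  U.Infinite ∧ (∀ u ∈ U, IsOpen u) ∧ ∀ x : X, {u ∈ U | x ∉ u}.Finite

/-- A γ-set (γ-space): every open ω-cover contains a countable subfamily which
is a γ-cover. -/
def GammaSpace (X : Type*) [TopologicalSpace X] : Prop :=
  ∀ U : Set (Set X), IsOmegaCover U →
    ∃ V ⊆ U, V.Countable ∧ IsGammaCover V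

open Filter

/-- Relative, sequential form of the γ-property. -/
def RelGamma {Z : Type*} [TopologicalSpace Z] (Y : Set Z) : Prop :=
  ∀ U : Set (Set Z), (∀ u ∈ U, IsOpen u) →
    (∀ F : Set Z, F.Finite → F ⊆ Y → ∃ u ∈ U, F ⊆ u) →
    ∃ s : ℕ → Set Z, (∀ n, s n ∈ U) ∧ ∀ y ∈ Y, ∀ᶠ n in atTop, y ∈ s n

theorem relGamma_range {T Z : Type*} [TopologicalSpace T] [TopologicalSpace Z]
    (i : T → Z) (hi : Continuous i) (h : GammaSpace T) : RelGamma (Set.range i) := by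
  intro U hU hω
  by_cases hun : ∃ u ∈ U, i ⁻¹' u = Set.univ
  · obtain ⟨u, hu, hu'⟩ := hun
    refine ⟨fun _ => u, fun _ => hu, ?_⟩
    rintro _ ⟨t, rfl⟩
    refine Eventually.of_forall fun _ => ?_
    have : t ∈ i ⁻¹' u := hu' ▸ Set.mem_univ t
    exact this
  · have key : ∀ F : Set T, F.Finite → ∃ u ∈ (fun u => i ⁻¹' u) '' U, F ⊆ u := by
      intro F hF
      obtain ⟨u, hu, hFu⟩ := hω (i '' F) (hF.image i) (Set.image_subset_range i F)
      exact ⟨_, ⟨u, hu, rfl⟩, Set.image_subset_iff.1 hFu⟩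
    obtain ⟨V, hVU, -, hVinf, -, hV⟩ := h ((fun u => i ⁻¹' u) '' U) ⟨by
        rintro _ ⟨u, hu, rfl⟩
        exact (hU u hu).preimage hi, by
        refine Set.eq_univ_of_forall fun t => ?_
        obtain ⟨u, hu, htu⟩ := key {t} (Set.finite_singleton t)
        exact ⟨u, hu, htu rfl⟩, by
        rintro ⟨u, hu, hu'⟩
        exact hun ⟨u, hu, hu'⟩, key⟩
    let e := hVinf.natEmbedding
    choose s hsU hs using fun n => hVU (e n).2
    refine ⟨s, hsU, ?_⟩
    rintro _ ⟨t, rfl⟩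
    have hfin : {n | t ∉ (e n : Set T)}.Finite := by
      have := (hV t).preimage (f := fun n => (e n : Set T))
        (fun a _ b _ hab => e.injective (Subtype.ext hab))
      refine this.subset fun n hn => ⟨(e n).2, hn⟩
    have := hfin.eventually_cofinite_notMem
    rw [Nat.cofinite_eq_atTop] at this
    filter_upwards [this] with n hn
    have h1 : t ∈ (e n : Set T) := by simpa using hn
    rw [← hs n] at h1
    exact h1

theorem gammaSpace_of_relGamma {Z : Type*} [TopologicalSpace Z]
    (h : ∀ U : Set (Set Z), (∀ u ∈ U, IsOpen u) →
      (∀ F : Set Z, F.Finite → ∃ u ∈ U, F ⊆ u) →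
      ∃ s : ℕ → Set Z, (∀ n, s n ∈ U) ∧ ∀ y, ∀ᶠ n in atTop, y ∈ s n) : GammaSpace Z := by
  rintro U ⟨hU, -, hun, hω⟩
  obtain ⟨s, hsU, hs⟩ := h U hU hω
  have hsub : Set.range s ⊆ U := by
    rintro _ ⟨n, rfl⟩
    exact hsU n
  refine ⟨Set.range s, hsub, Set.countable_range s, ?_, fun u hu => hU u (hsub hu), ?_⟩
  · intro hfin
    have : ∃ u ∈ Set.range s, ∃ᶠ n in atTop, s n = u := by
      by_contra hcon
      push Not at hcon
      have h2 := (Set.Finite.eventually_all hfin).2 hcon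
      obtain ⟨n, hn⟩ := h2.exists
      exact hn (s n) ⟨n, rfl⟩ rfl
    obtain ⟨u, hu, hfr⟩ := this
    apply hun
    have : u = Set.univ := by
      refine Set.eq_univ_of_forall fun y => ?_
      obtain ⟨n, hn, hy⟩ := (hfr.and_eventually (hs y)).exists
      exact hn ▸ hy
    exact this ▸ hsub hu
  · intro x
    have h1 := hs x
    rw [← Nat.cofinite_eq_atTop, eventually_cofinite] at h1
    refine (h1.image s).subset ?_
    rintro _ ⟨⟨n, rfl⟩, hn⟩
    exact ⟨n, hn, rfl⟩

theorem RelGamma.select {Z : Type*} [TopologicalSpace Z] [T1Space Z] {Y : Set Z}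
    (h : RelGamma Y) (U : ℕ → ℕ → Set Z) (hU : ∀ n m, IsOpen (U n m))
    (hc : ∀ y ∈ Y, ∀ n, ∀ᶠ m in atTop, y ∈ U n m) :
    ∃ f : ℕ → ℕ, ∀ y ∈ Y, ∀ᶠ n in atTop, y ∈ U n (f n) := by
  rcases Y.finite_or_infinite with hY | hY
  · have : ∀ n, ∃ m, ∀ y ∈ Y, y ∈ U n m := fun n =>
      ((Set.Finite.eventually_all hY).2 fun y hy => hc y hy n).exists
    choose f hf using this
    exact ⟨f, fun y hy => Eventually.of_forall fun n => hf n y hy⟩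
  · let x := hY.natEmbedding
    obtain ⟨s, hs, hsc⟩ := h
      (Set.range fun p : ℕ × ℕ => (⋂ i ∈ Set.Iic p.1, U i p.2) \ {(x p.1 : Z)}) (by
        rintro _ ⟨p, rfl⟩
        refine IsOpen.sdiff ?_ isClosed_singleton
        exact (Set.finite_Iic p.1).isOpen_biInter fun i _ => hU i p.2) (by
        intro F hF hFY
        have hfin : {n | (x n : Z) ∈ F}.Finite :=
          hF.preimage (f := fun n => (x n : Z))
            (fun a _ b _ hab => x.injective (Subtype.ext hab))
        obtain ⟨n, hn⟩ := hfin.exists_notMem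
        have h1 : ∀ᶠ m in atTop, ∀ y ∈ F, ∀ i ∈ Set.Iic n, y ∈ U i m :=
          (Set.Finite.eventually_all hF).2 fun y hy =>
            (Set.Finite.eventually_all (Set.finite_Iic n)).2 fun i _ => hc y (hFY hy) i
        obtain ⟨m, hm⟩ := h1.exists
        refine ⟨_, ⟨(n, m), rfl⟩, fun y hy => ⟨?_, ?_⟩⟩
        · exact Set.mem_iInter₂.2 fun i hi => hm y hy i hi
        · rintro rfl
          exact hn hy)
    choose p hp using hs
    have hne : ∀ N, ∀ᶠ k in atTop, (p k).1 ≠ N := by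
      intro N
      filter_upwards [hsc (x N) (x N).2] with k hk heq
      rw [← hp k] at hk
      exact hk.2 (by rw [heq]; rfl)
    have hex : ∀ i, ∃ k, i ≤ k ∧ i ≤ (p k).1 := by
      intro i
      have h1 : ∀ᶠ k in atTop, ∀ N ∈ Set.Iio i, (p k).1 ≠ N :=
        (Set.Finite.eventually_all (Set.finite_Iio i)).2 fun N _ => hne N
      obtain ⟨k, hk, hik⟩ := (h1.and (eventually_ge_atTop i)).exists
      exact ⟨k, hik, not_lt.1 fun hlt => hk _ hlt rfl⟩
    choose k hk1 hk2 using hex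
    refine ⟨fun i => (p (k i)).2, fun y hy => ?_⟩
    obtain ⟨K, hK⟩ := eventually_atTop.1 (hsc y hy)
    filter_upwards [eventually_ge_atTop K] with i hi
    have h1 := hK (k i) (hi.trans (hk1 i))
    rw [← hp (k i)] at h1
    exact Set.mem_iInter₂.1 h1.1 i (hk2 i)

/-- Arrays whose `n`-th row converges on `Y (k + n)`. -/
def ConvArray {Z : Type*} (U : Set (Set Z)) (Y : ℕ → Set Z) (k : ℕ)
    (B : ℕ → ℕ → Set Z) : Prop :=
  (∀ n j, B n j ∈ U) ∧ ∀ n, ∀ y ∈ Y (k + n), ∀ᶠ j in atTop, y ∈ B n j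

theorem ConvArray.step {Z : Type*} [TopologicalSpace Z] [T1Space Z] {U : Set (Set Z)}
    (hU : ∀ u ∈ U, IsOpen u) {Y : ℕ → Set Z} (hY : Monotone Y) (hG : ∀ n, RelGamma (Y n))
    (k : ℕ) (B : ℕ → ℕ → Set Z) (hB : ConvArray U Y k B) :
    ∃ B', ConvArray U Y (k + 1) B' ∧ (∀ n j, ∃ j', B' n j = B (n + 1) j') ∧
      ∀ y ∈ Y k, ∀ᶠ n in atTop, ∀ j, y ∈ B' n j := by
  obtain ⟨f, hf⟩ := (hG k).select
    (fun p m => B (Nat.unpair p).1 (m + (Nat.unpair p).2)) (fun p m => hU _ (hB.1 _ _))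
    (fun y hy p => by
      have h1 := hB.2 (Nat.unpair p).1 y (hY (Nat.le_add_right _ _) hy)
      exact (tendsto_add_atTop_nat _).eventually h1)
  refine ⟨fun n j => B (n + 1) (f (Nat.pair (n + 1) j) + j), ⟨fun n j => hB.1 _ _, ?_⟩,
    fun n j => ⟨_, rfl⟩, ?_⟩
  · intro n y hy
    have h1 := hB.2 (n + 1) y (by rwa [show k + (n + 1) = k + 1 + n by omega])
    obtain ⟨J, hJ⟩ := eventually_atTop.1 h1
    filter_upwards [eventually_ge_atTop J] with j hj
    exact hJ _ (by omega)
  · intro y hy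
    obtain ⟨P, hP⟩ := eventually_atTop.1 (hf y hy)
    filter_upwards [eventually_ge_atTop P] with n hn j
    have h1 := hP (Nat.pair (n + 1) j)
      (le_trans (by omega : P ≤ n + 1) (Nat.left_le_pair _ _))
    simpa using h1

theorem relGamma_increasing {Z : Type*} [TopologicalSpace Z] [T1Space Z]
    {Y : ℕ → Set Z} (hY : Monotone Y) (hG : ∀ n, RelGamma (Y n))
    (hcov : ∀ z, ∃ n, z ∈ Y n) : GammaSpace Z := by
  apply gammaSpace_of_relGamma
  intro U hU hω
  choose V hVU hV using fun n => hG n U hU (fun F hF _ => hω F hF)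
  choose! S hS1 hS2 hS3 using fun k B hB => ConvArray.step hU hY hG k B hB
  let B : ℕ → ℕ → ℕ → Set Z := fun k => Nat.rec V (fun k b => S k b) k
  have hBs : ∀ k, B (k + 1) = S k (B k) := fun k => rfl
  have hB : ∀ k, ConvArray U Y k (B k) := by
    intro k
    induction k with
    | zero => exact ⟨hVU, fun n y hy => hV n y (by simpa using hy)⟩
    | succ k ih => rw [hBs]; exact hS1 k _ ih
  have hsub : ∀ i d n j, ∃ j', B (i + d) n j = B i (n + d) j' := by
    intro i d
    induction d with
    | zero => exact fun n j => ⟨j, rfl⟩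
    | succ d ih =>
      intro n j
      obtain ⟨j1, h1⟩ := hS2 (i + d) _ (hB (i + d)) n j
      obtain ⟨j2, h2⟩ := ih (n + 1) j1
      refine ⟨j2, ?_⟩
      rw [← add_assoc, hBs, h1, h2, show n + 1 + d = n + (d + 1) by omega]
  refine ⟨fun k => B k 0 0, fun k => (hB k).1 0 0, fun y => ?_⟩
  obtain ⟨i, hi⟩ := hcov y
  obtain ⟨N, hN⟩ := eventually_atTop.1 (hS3 i _ (hB i) y hi)
  filter_upwards [eventually_ge_atTop (i + 1 + N)] with k hk
  obtain ⟨d, rfl⟩ := Nat.exists_eq_add_of_le (show i + 1 ≤ k by omega)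
  obtain ⟨j, hj⟩ := hsub (i + 1) d 0 0
  rw [hj, hBs]
  exact hN _ (by omega) _

/-- An increasing countable union of γ-sets of reals is a γ-set. -/
theorem iUnion_gammaSpace_of_monotone (X : ℕ → Set ℝ)
    (hmono : ∀ n, X n ⊆ X (n + 1))
    (hγ : ∀ n, GammaSpace ↥(X n)) :
    GammaSpace ↥(⋃ n, X n) := by
  have hm : Monotone X := monotone_nat_of_le_succ hmono
  have hr : ∀ n, Set.range (Set.inclusion (Set.subset_iUnion X n)) =
      {z : ↥(⋃ n, X n) | (z : ℝ) ∈ X n} := fun n => Set.range_inclusion _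
  refine relGamma_increasing (Y := fun n => {z : ↥(⋃ n, X n) | (z : ℝ) ∈ X n}) ?_ ?_ ?_
  · intro a b hab z hz
    exact hm hab hz
  · intro n
    rw [← hr n]
    exact relGamma_range _ (continuous_inclusion _) (hγ n)
  · intro z
    obtain ⟨n, hn⟩ := Set.mem_iUnion.1 z.2
    exact ⟨n, hn⟩
end

section
/- For a set of reals X (with the subspace topology): X is a λ-space with the Hurewicz property if and only if every co-countable subset of X (i.e., every set X \ Y with Y ⊆ X countable) has the Hurewicz property. -/
/-- A λ-space: every countable subset is a relative G_δ. -/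
def LambdaSpace (X : Type*) [TopologicalSpace X] : Prop :=
  ∀ C : Set X, C.Countable → IsGδ C

/-- The Hurewicz covering property: for every sequence of open covers there are
finite subfamilies such that every point is in the union of all but finitely
many of them. -/
def HurewiczProp (X : Type*) [TopologicalSpace X] : Prop :=
  ∀ U : ℕ → Set (Set X),
    (∀ n, (∀ u ∈ U n, IsOpen u) ∧ ⋃₀ U n = Set.univ) →
    ∃ V : ℕ → Set (Set X),
      (∀ n, V n ⊆ U n ∧ (V n).Finite) ∧
      ∀ x : X, ∀ᶠ n in Filter.atTop, x ∈ ⋃₀ V n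

theorem hurewicz_of_inducing {A B : Type*} [TopologicalSpace A] [TopologicalSpace B]
    (i : A → B) (hi : Topology.IsInducing i) (hG : IsGδ (Set.range i)ᶜ)
    (hB : HurewiczProp B) : HurewiczProp A := by
  intro U hU
  obtain ⟨f, hf, hfe⟩ := isGδ_iff_eq_iInter_nat.1 hG
  let O : ℕ → Set B := fun n => ⋂ k ∈ Set.Iic n, f k
  have hO : ∀ n, IsOpen (O n) := fun n => (Set.finite_Iic n).isOpen_biInter fun k _ => hf k
  let W : ℕ → Set (Set B) := fun n => insert (O n) {w | IsOpen w ∧ i ⁻¹' w ∈ U n}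
  obtain ⟨V, hV, hV2⟩ := hB W (by
    intro n
    refine ⟨?_, ?_⟩
    · rintro u (rfl | hu)
      · exact hO n
      · exact hu.1
    · refine Set.eq_univ_of_forall fun x => ?_
      by_cases hx : x ∈ Set.range i
      · obtain ⟨a, rfl⟩ := hx
        have ha : a ∈ ⋃₀ U n := by rw [(hU n).2]; trivial
        obtain ⟨u, hu, hau⟩ := ha
        obtain ⟨w, hw, rfl⟩ := hi.isOpen_iff.1 ((hU n).1 u hu)
        exact ⟨w, Or.inr ⟨hw, hu⟩, hau⟩
      · refine ⟨O n, Or.inl rfl, ?_⟩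
        have : x ∈ ⋂ n, f n := hfe ▸ hx
        exact Set.mem_iInter₂.2 fun k _ => Set.mem_iInter.1 this k)
  refine ⟨fun n => ((fun w => i ⁻¹' w) '' V n) ∩ U n, fun n => ⟨Set.inter_subset_right,
    ((hV n).2.image _).inter_of_left _⟩, fun a => ?_⟩
  have h1 : ∃ k, i a ∉ f k := by
    by_contra! h
    have : i a ∈ (Set.range i)ᶜ := hfe ▸ Set.mem_iInter.2 h
    exact this ⟨a, rfl⟩
  obtain ⟨k, hk⟩ := h1
  filter_upwards [hV2 (i a), Filter.eventually_ge_atTop k] with n hn hkn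
  obtain ⟨w, hw, haw⟩ := hn
  rcases (hV n).1 hw with rfl | h
  · exact absurd (Set.mem_iInter₂.1 haw k hkn) hk
  · exact ⟨i ⁻¹' w, ⟨⟨w, hw, rfl⟩, h.2⟩, haw⟩

theorem isGδ_of_hurewicz {A B : Type*} [TopologicalSpace A] [MetricSpace B]
    (i : A → B) (hi : Continuous i) (hc : (Set.range i)ᶜ.Countable)
    (hA : HurewiczProp A) : IsGδ (Set.range i)ᶜ := by
  rcases Set.eq_empty_or_nonempty (Set.range i)ᶜ with he | hne
  · rw [he]; exact IsGδ.empty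
  obtain ⟨c, hce⟩ := hc.exists_eq_range hne
  let d : ℕ → B := fun n => c n.unpair.1
  have hd : ∀ n a, i a ≠ d n := fun n a h => by
    have : d n ∈ (Set.range i)ᶜ := hce ▸ ⟨_, rfl⟩
    exact this ⟨a, h⟩
  let S : ℕ → ℕ → Set A := fun n k => {a | 1 / ((k : ℝ) + 1) < dist (i a) (d n)}
  obtain ⟨V, hV, hV2⟩ := hA (fun n => Set.range (S n)) (by
    intro n
    refine ⟨?_, ?_⟩
    · rintro _ ⟨k, rfl⟩
      exact isOpen_lt continuous_const (hi.dist continuous_const)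
    · refine Set.eq_univ_of_forall fun a => ?_
      obtain ⟨k, hk⟩ := exists_nat_one_div_lt (dist_pos.2 (hd n a))
      exact ⟨_, ⟨k, rfl⟩, hk⟩)
  have hk : ∀ n, ∃ k, ⋃₀ V n ⊆ S n k := by
    intro n
    obtain ⟨T, -, hTf, hTe⟩ := Set.exists_subset_image_finite_and.1
      (⟨V n, by simpa using (hV n).1, (hV n).2, rfl⟩ :
        ∃ t ⊆ S n '' Set.univ, t.Finite ∧ t = V n)
    obtain ⟨k, hk⟩ := hTf.bddAbove
    refine ⟨k, ?_⟩
    rw [← hTe]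
    rintro a ⟨_, ⟨j, hj, rfl⟩, ha⟩
    have hjk : (j : ℝ) ≤ k := by exact_mod_cast hk hj
    have hle : 1 / ((k : ℝ) + 1) ≤ 1 / ((j : ℝ) + 1) :=
      one_div_le_one_div_of_le (by positivity) (by linarith)
    have ha' : 1 / ((j : ℝ) + 1) < dist (i a) (d n) := ha
    exact lt_of_le_of_lt hle ha'
  choose k hk using hk
  have key : (Set.range i)ᶜ =
      ⋂ m : ℕ, ⋃ n ∈ Set.Ici m, {x | dist x (d n) < 1 / ((k n : ℝ) + 1)} := by
    ext x
    simp only [Set.mem_iInter, Set.mem_iUnion, Set.mem_Ici, Set.mem_ofPred_eq, exists_prop]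
    constructor
    · intro hx m
      rw [hce] at hx
      obtain ⟨j, rfl⟩ := hx
      refine ⟨Nat.pair j m, Nat.right_le_pair j m, ?_⟩
      simp only [d, Nat.unpair_pair, dist_self]
      positivity
    · rintro h ⟨a, rfl⟩
      obtain ⟨m, hm⟩ := Filter.eventually_atTop.1 (hV2 a)
      obtain ⟨n, hn, hlt⟩ := h m
      exact lt_asymm hlt (hk n (hm n hn))
  rw [key]
  exact IsGδ.iInter_of_isOpen fun m => isOpen_biUnion fun n _ =>
    isOpen_lt (continuous_id.dist continuous_const) continuous_const

/-- A set of reals is a λ-space with the Hurewicz property if and only if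
every co-countable subset of it has the Hurewicz property. -/
theorem lambdaSpace_and_hurewicz_iff_cocountable_hurewicz (X : Set ℝ) :
    (LambdaSpace ↥X ∧ HurewiczProp ↥X) ↔
      ∀ Y : Set ℝ, Y ⊆ X → Y.Countable → HurewiczProp ↥(X \ Y) := by
  have hr : ∀ Y : Set ℝ, (Set.range (Set.inclusion (Set.sdiff_subset : X \ Y ⊆ X)))ᶜ =
      ((↑) : X → ℝ) ⁻¹' Y := by
    intro Y
    ext x
    simp [Set.range_inclusion]
  constructor
  · rintro ⟨hl, hh⟩ Y hY hc
    refine hurewicz_of_inducing (Set.inclusion (Set.sdiff_subset : X \ Y ⊆ X))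
      (Topology.IsEmbedding.inclusion _).isInducing (hl _ ?_) hh
    rw [hr]
    exact hc.preimage Subtype.val_injective
  · intro h
    refine ⟨fun C hC => ?_, ?_⟩
    · have hY := h (((↑) : X → ℝ) '' C) (by simp) (hC.image _)
      have e := hr (((↑) : X → ℝ) '' C)
      rw [Set.preimage_image_eq _ Subtype.val_injective] at e
      have := isGδ_of_hurewicz _ (continuous_inclusion Set.sdiff_subset) (by rw [e]; exact hC) hY
      rwa [e] at this
    · have := h ∅ (Set.empty_subset _) Set.countable_empty
      rwa [Set.sdiff_empty] at this
end

section
/- Let κ ≤ λ be uncountable cardinals and let F be a family of subsets of λ, each of cardinality κ, such that every subset of λ either contains a member of F or is disjoint from a member of F. Then the cardinality of F is at least cov(N), the covering number of the Lebesgue null ideal. -/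
/-- `cov(N)`: the least cardinality of a family of Lebesgue measure-zero
subsets of `ℝ` covering `ℝ`. -/
noncomputable def covNull : Cardinal :=
  sInf { c : Cardinal |
    ∃ S : Set (Set ℝ), Cardinal.mk S = c ∧
      (∀ s ∈ S, MeasureTheory.volume s = 0) ∧ ⋃₀ S = Set.univ }

open MeasureTheory Set Filter Topology
open scoped Pointwise

/-- Fewer than `cov(N)` null sets do not cover the line. -/
theorem exists_avoid_of_lt_covNull {ι : Type} (h : Cardinal.mk ι < covNull)
    (N : ι → Set ℝ) (hN : ∀ i, volume (N i) = 0) : ∃ x : ℝ, ∀ i, x ∉ N i := by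
  by_contra hcon
  push Not at hcon
  have h1 : covNull ≤ Cardinal.mk (range N) := by
    unfold covNull
    apply csInf_le'
    refine ⟨range N, rfl, ?_, ?_⟩
    · rintro s ⟨i, rfl⟩
      exact hN i
    · rw [sUnion_range, eq_univ_iff_forall]
      intro x
      exact mem_iUnion.2 (hcon x)
  exact absurd (h1.trans Cardinal.mk_range_le) (not_le.2 h)

theorem steinhaus_real (E : Set ℝ) (hE : MeasurableSet E) (hpos : volume E ≠ 0) :
    ∃ ε > 0, ∀ t : ℝ, |t| < ε → ∃ x ∈ E, ∃ y ∈ E, x - y = t := by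
  have h := Measure.sub_mem_nhds_zero_of_addHaar_pos volume E hE (pos_iff_ne_zero.2 hpos)
  obtain ⟨ε, hε, hb⟩ := Metric.mem_nhds_iff.1 h
  refine ⟨ε, hε, fun t ht => ?_⟩
  have : t ∈ E - E := hb (by simpa using ht)
  exact Set.mem_sub.1 this

/-- The rational translates of a set of positive measure cover almost everything. -/
theorem rat_translates_conull (P : Set ℝ) (hP : IsClosed P) (hpos : volume P ≠ 0) :
    volume {r : ℝ | ∀ q : ℚ, r - q ∉ P} = 0 := by
  by_contra hQ
  set Q : Set ℝ := {r : ℝ | ∀ q : ℚ, r - q ∉ P} with hQdef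
  have hQm : MeasurableSet Q := by
    have : Q = ⋂ q : ℚ, (fun r : ℝ => r - q) ⁻¹' Pᶜ := by
      ext r; simp [hQdef]
    rw [this]
    exact MeasurableSet.iInter fun q => (measurable_id.sub_const _) hP.measurableSet.compl
  have key : ∃ t : ℝ, volume {x : ℝ | x ∈ P ∧ x - t ∈ Q} ≠ 0 := by
    by_contra hcon
    push Not at hcon
    have h1 : ∀ᵐ t : ℝ, ∀ᵐ x : ℝ, ¬ (x ∈ P ∧ x - t ∈ Q) := by
      refine Eventually.of_forall fun t => ?_
      rw [ae_iff]
      simpa using hcon t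
    have hm : MeasurableSet {p : ℝ × ℝ | ¬ (p.2 ∈ P ∧ p.2 - p.1 ∈ Q)} := by
      apply MeasurableSet.compl
      exact (measurable_snd hP.measurableSet).inter
        ((measurable_snd.sub measurable_fst) hQm)
    have h2 := (Measure.ae_ae_comm (μ := volume) (ν := volume) hm).1 h1
    have h3 : ∃ x ∈ P, ∀ᵐ t : ℝ, ¬ (x ∈ P ∧ x - t ∈ Q) := by
      by_contra hno
      push Not at hno
      apply hpos
      refine measure_mono_null ?_ (ae_iff.1 h2)
      intro x hx
      have := hno x hx
      simpa using this
    obtain ⟨x, hx, h4⟩ := h3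
    apply hQ
    have h5 : volume ((fun t : ℝ => x - t) ⁻¹' Q) = 0 := by
      rw [ae_iff] at h4
      simp only [hx, true_and, not_not] at h4
      exact h4
    rwa [(Measure.measurePreserving_sub_left volume x).measure_preimage hQm.nullMeasurableSet] at h5
  obtain ⟨t, ht⟩ := key
  have hEm : MeasurableSet {x : ℝ | x ∈ P ∧ x - t ∈ Q} :=
    hP.measurableSet.inter ((measurable_id.sub_const t) hQm)
  obtain ⟨ε, hε, hs⟩ := steinhaus_real _ hEm ht
  obtain ⟨q, hq1, hq2⟩ := exists_rat_btwn (show t - ε < t by linarith)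
  obtain ⟨x, hx, y, hy, hxy⟩ := hs (q - t) (by rw [abs_lt]; constructor <;> linarith)
  have h6 := hy.2 (-q)
  apply h6
  have : y - t - ((-q : ℚ) : ℝ) = x := by push_cast; linarith
  rw [this]
  exact hx.1

/-- Stage 1: points whose restriction to every member of `F` has non-null closure. -/
theorem stage_one {Λ : Type} (F : Set (Set Λ)) (hF : ∀ B ∈ F, ¬ B.Countable)
    (hlt : Cardinal.mk F < covNull) :
    ∃ y : Λ → ℝ, ∀ B ∈ F, volume (closure (y '' B)) ≠ 0 := by
  classical
  let R : Λ → Λ → Prop := WellOrderingRel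
  have wf : WellFounded R := IsWellFounded.wf
  have step : ∀ (a : Λ) (g : (b : Λ) → R b a → ℝ), ∃ x : ℝ, ∀ B : F,
      x ∉ (if volume (closure {z : ℝ | ∃ b, ∃ h : R b a, b ∈ B.1 ∧ g b h = z}) = 0 then
        closure {z : ℝ | ∃ b, ∃ h : R b a, b ∈ B.1 ∧ g b h = z} else ∅) := by
    intro a g
    apply exists_avoid_of_lt_covNull hlt
    intro B
    split_ifs with h
    · exact h
    · exact measure_empty
  choose nxt hnxt using step
  let y : Λ → ℝ := wf.fix nxt
  have hy : ∀ a, y a = nxt a (fun b _ => y b) := fun a => wf.fix_eq nxt a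
  refine ⟨y, fun B hB hnull => hF B hB ?_⟩
  have hsep : ∀ a ∈ B, y a ∉ closure (y '' {b | b ∈ B ∧ R b a}) := by
    intro a _
    have h1 := hnxt a (fun b _ => y b) ⟨B, hB⟩
    rw [← hy a] at h1
    have h2 : {z : ℝ | ∃ b, ∃ _ : R b a, b ∈ B ∧ y b = z} = y '' {b | b ∈ B ∧ R b a} := by
      ext z
      constructor
      · rintro ⟨b, h, hb, rfl⟩
        exact ⟨b, ⟨hb, h⟩, rfl⟩
      · rintro ⟨b, ⟨hb, h⟩, rfl⟩
        exact ⟨b, h, hb, rfl⟩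
    simp only [h2] at h1
    rwa [if_pos] at h1
    exact measure_mono_null (closure_mono (image_mono fun b hb => hb.1)) hnull
  have hbase : ∀ a : B, ∃ U ∈ TopologicalSpace.countableBasis ℝ,
      y a ∈ U ∧ ∀ b ∈ B, R b a → y b ∉ U := by
    intro a
    obtain ⟨U, hU, hyU, hsub⟩ :=
      (TopologicalSpace.isBasis_countableBasis ℝ).exists_subset_of_mem_open
        (show y a ∈ (closure (y '' {b | b ∈ B ∧ R b a}))ᶜ from hsep a a.2)
        isClosed_closure.isOpen_compl
    exact ⟨U, hU, hyU, fun b hb hR hbU => hsub hbU (subset_closure ⟨b, ⟨hb, hR⟩, rfl⟩)⟩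
  choose U hU hyU hUn using hbase
  have hinj : Function.Injective
      (fun a : B => (⟨U a, hU a⟩ : TopologicalSpace.countableBasis ℝ)) := by
    intro a b hab
    have hab' : U a = U b := congrArg Subtype.val hab
    rcases trichotomous_of R a.1 b.1 with h | h | h
    · exact absurd (hab' ▸ hyU a) (hUn b a a.2 h)
    · exact Subtype.ext h
    · exact absurd (hab' ▸ hyU b) (hUn a b b.2 h)
  have : Countable (TopologicalSpace.countableBasis ℝ) :=
    (TopologicalSpace.countable_countableBasis ℝ).to_subtype
  exact Set.countable_coe_iff.1 hinj.countable

/-- Stage 2: a map to `ℕ` with infinite image on every member of `F`. -/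
theorem stage_two {Λ : Type} (F : Set (Set Λ)) (hlt : Cardinal.mk F < covNull)
    (y : Λ → ℝ) (hy : ∀ B ∈ F, volume (closure (y '' B)) ≠ 0) :
    ∃ f : Λ → ℕ, ∀ B ∈ F, (f '' B).Infinite := by
  classical
  obtain ⟨e, he⟩ := exists_surjective_nat ℚ
  let q : ℕ → ℝ := fun m => (e m.unpair.1 : ℝ)
  let T : Λ → ℝ → Set ℕ := fun a r => {m | r ∈ Metric.ball (y a + q m) ((1 / 2) ^ m)}
  have hT : ∀ a, volume {r | ¬ (T a r).Finite} = 0 := by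
    intro a
    rw [← ae_iff]
    refine ae_finite_setOfPred_mem ?_
    simp only [Real.volume_ball]
    have : Summable fun m : ℕ => 2 * ((1 : ℝ) / 2) ^ m :=
      (summable_geometric_of_lt_one (by norm_num) (by norm_num)).mul_left 2
    exact this.tsum_ofReal_ne_top
  have hC : ∀ B : F, ∃ C : Set Λ, C ⊆ B.1 ∧ C.Countable ∧ y '' B.1 ⊆ closure (y '' C) := by
    intro B
    obtain ⟨c, hcs, hcc, hcd⟩ :=
      (TopologicalSpace.IsSeparable.of_separableSpace (y '' B.1)).exists_countable_dense_subset
    obtain ⟨C, hCB, hCi⟩ := SurjOn.exists_bijOn_subset (show SurjOn y B.1 c from hcs)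
    refine ⟨C, hCB, ?_, ?_⟩
    · exact hCi.mapsTo.countable_of_injOn hCi.injOn hcc
    · rw [hCi.image_eq]; exact hcd
  choose C hCB hCc hCd using hC
  obtain ⟨r, hr⟩ := exists_avoid_of_lt_covNull hlt
    (fun B : F => {r : ℝ | ∀ p : ℚ, r - p ∉ closure (y '' B.1)} ∪
      ⋃ a ∈ C B, {r | ¬ (T a r).Finite}) (by
    intro B
    refine measure_union_null (rat_translates_conull _ isClosed_closure (hy B.1 B.2)) ?_
    exact (measure_biUnion_null_iff (hCc B)).2 fun a _ => hT a)
  refine ⟨fun a => sSup (T a r), fun B hB => ?_⟩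
  have h := hr ⟨B, hB⟩
  simp only [mem_union, not_or, mem_iUnion, not_exists, mem_ofPred_eq, not_forall, not_not] at h
  obtain ⟨⟨p, hp⟩, hfin⟩ := h
  obtain ⟨i, hi⟩ := he p
  apply Set.infinite_of_not_bddAbove
  rintro ⟨M, hM⟩
  let m := Nat.pair i (M + 1)
  have hmM : M + 1 ≤ m := Nat.right_le_pair _ _
  have hqm : q m = p := by simp [q, m, hi]
  have hp' : r - p ∈ closure (y '' C ⟨B, hB⟩) :=
    closure_minimal (hCd ⟨B, hB⟩) isClosed_closure hp
  obtain ⟨_, ⟨a, ha, rfl⟩, had⟩ := Metric.mem_closure_iff.1 hp' ((1 / 2) ^ m) (by positivity)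
  have hmem : m ∈ T a r := by
    change dist r (y a + q m) < _
    rw [hqm]
    rw [Real.dist_eq] at had ⊢
    rwa [show r - (y a + (p : ℝ)) = r - p - y a by ring]
  have h1 : m ≤ sSup (T a r) := le_csSup (hfin a ha).bddAbove hmem
  have h2 : sSup (T a r) ≤ M := hM ⟨a, hCB _ ha, rfl⟩
  omega

theorem parity_null (S : Set ℕ) (hS : S.Infinite) (p : ℤ → Prop)
    (hp : ∀ k, p k → ¬ p (k + 1)) :
    volume {s : ℝ | ∀ n ∈ S, p ⌊(2 : ℝ) ^ n * s⌋} = 0 := by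
  by_contra hpos
  have hm : MeasurableSet {s : ℝ | ∀ n ∈ S, p ⌊(2 : ℝ) ^ n * s⌋} := by
    have : {s : ℝ | ∀ n ∈ S, p ⌊(2 : ℝ) ^ n * s⌋} =
        ⋂ n ∈ S, (fun s : ℝ => ⌊(2 : ℝ) ^ n * s⌋) ⁻¹' {k | p k} := by
      ext s; simp
    rw [this]
    refine MeasurableSet.biInter S.to_countable fun n _ => ?_
    exact (Int.measurable_floor.comp (measurable_id.const_mul _)) (MeasurableSet.of_discrete)
  obtain ⟨ε, hε, hs⟩ := steinhaus_real _ hm hpos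
  obtain ⟨N, hN⟩ := exists_pow_lt_of_lt_one hε (show (1 / 2 : ℝ) < 1 by norm_num)
  obtain ⟨n, hnS, hn⟩ := hS.exists_gt N
  obtain ⟨x, hx, z, hz, hxz⟩ := hs ((1 / 2) ^ n) (by
    rw [abs_of_pos (by positivity)]
    exact (pow_le_pow_of_le_one (by norm_num) (by norm_num) hn.le).trans_lt hN)
  refine hp _ (hz n hnS) ?_
  have h1 : (2 : ℝ) ^ n * x = 2 ^ n * z + 1 := by
    have : x = z + (1 / 2) ^ n := by linarith
    rw [this, mul_add, ← mul_pow]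
    norm_num
  have h2 := hx n hnS
  rwa [h1, Int.floor_add_one] at h2

/-- If `κ ≤ λ` are uncountable cardinals and `F ⊆ [λ]^κ` is such that every
subset of `λ` contains, or is disjoint from, a member of `F`, then `F` has
size at least `cov(N)`. -/
theorem covNull_le_card_of_contain_or_disjoint
    (κ lam : Cardinal) (hκ : Cardinal.aleph0 < κ) (hlam : Cardinal.aleph0 < lam)
    (hκlam : κ ≤ lam)
    (Λ : Type) (hΛ : Cardinal.mk Λ = lam)
    (F : Set (Set Λ)) (hF : ∀ B ∈ F, Cardinal.mk B = κ)
    (hdich : ∀ A : Set Λ, ∃ B ∈ F, B ⊆ A ∨ Disjoint B A) :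
    covNull ≤ Cardinal.mk F := by
  by_contra hcon
  have hlt : Cardinal.mk F < covNull := not_le.1 hcon
  have hunc : ∀ B ∈ F, ¬ B.Countable := by
    intro B hB hc
    have := Cardinal.le_aleph0_iff_set_countable.2 hc
    rw [hF B hB] at this
    exact absurd this (not_le.2 hκ)
  obtain ⟨y, hy⟩ := stage_one F hunc hlt
  obtain ⟨f, hf⟩ := stage_two F hlt y hy
  obtain ⟨s, hs⟩ := exists_avoid_of_lt_covNull hlt
    (fun B : F => {s : ℝ | ∀ n ∈ f '' B.1, Even ⌊(2 : ℝ) ^ n * s⌋} ∪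
      {s : ℝ | ∀ n ∈ f '' B.1, ¬ Even ⌊(2 : ℝ) ^ n * s⌋}) (by
    intro B
    refine measure_union_null (parity_null _ (hf B.1 B.2) (fun k => Even k) ?_)
      (parity_null _ (hf B.1 B.2) (fun k => ¬ Even k) ?_)
    · intro k hk
      simpa [Int.even_add_one] using hk
    · intro k hk
      simpa [Int.even_add_one] using hk)
  obtain ⟨B, hB, h⟩ := hdich {a | Even ⌊(2 : ℝ) ^ (f a) * s⌋}
  refine hs ⟨B, hB⟩ ?_
  rcases h with h | h
  · left
    rintro _ ⟨a, ha, rfl⟩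
    exact h ha
  · right
    rintro _ ⟨a, ha, rfl⟩ he
    exact Set.disjoint_left.1 h ha he
end

section
/- A topological space X satisfies the selection principle S₁(Ω, Γ) (for every sequence (U_n) of open ω-covers of X one can choose U_n ∈ U_n so that {U_n : n ∈ ℕ} is a γ-cover of X) if and only if X has the γ-property (every open ω-cover of X contains a countable subfamily which is a γ-cover of X). -/
/-- The selection principle `S₁(Ω, Γ)`: from every sequence of open ω-covers
one can select one member of each so that the selected sets form a γ-cover. -/
def S1OmegaGamma (X : Type*) [TopologicalSpace X] : Prop :=
  ∀ U : ℕ → Set (Set X), (∀ n, IsOmegaCover (U n)) →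
    ∃ V : ℕ → Set X, (∀ n, V n ∈ U n) ∧ IsGammaCover (Set.range V)

theorem gamma_enum {X : Type*} [TopologicalSpace X] {V : Set (Set X)} (h : IsGammaCover V) :
    ∃ e : ℕ → Set X, (∀ j, e j ∈ V) ∧ ∀ x, ∀ᶠ j in Filter.atTop, x ∈ e j := by
  obtain ⟨hinf, -, hx⟩ := h
  let f := hinf.natEmbedding
  refine ⟨fun j => (f j : Set X), fun j => (f j).2, fun x => ?_⟩
  have hfin : {j | x ∉ (f j : Set X)}.Finite := by
    refine Set.Finite.of_finite_image (f := fun j => (f j : Set X)) ((hx x).subset ?_) ?_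
    · rintro _ ⟨j, hj, rfl⟩
      exact ⟨(f j).2, hj⟩
    · intro a _ b _ hab
      exact f.injective (Subtype.ext hab)
  have := hfin.compl_mem_cofinite
  rw [Nat.cofinite_eq_atTop] at this
  filter_upwards [this] with j hj
  simpa using hj

theorem gamma_of_seq {X : Type*} [TopologicalSpace X] (V : ℕ → Set X)
    (ho : ∀ n, IsOpen (V n)) (hp : ∀ n, V n ≠ Set.univ)
    (hx : ∀ x, ∀ᶠ n in Filter.atTop, x ∈ V n) : IsGammaCover (Set.range V) := by
  refine ⟨?_, ?_, ?_⟩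
  · intro hfin
    have hch : ∀ u ∈ Set.range V, ∃ x, x ∉ u := by
      rintro _ ⟨n, rfl⟩
      exact (Set.ne_univ_iff_exists_notMem _).1 (hp n)
    have : Nonempty X := ⟨(hch _ ⟨0, rfl⟩).choose⟩
    choose! p hpp using hch
    have : ∀ᶠ n in Filter.atTop, ∀ u ∈ Set.range V, p u ∈ V n :=
      (Filter.eventually_all_finite hfin).2 fun u _ => hx (p u)
    obtain ⟨n, hn⟩ := this.exists
    exact hpp (V n) ⟨n, rfl⟩ (hn _ ⟨n, rfl⟩)
  · rintro _ ⟨n, rfl⟩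
    exact ho n
  · intro x
    have h := hx x
    rw [← Nat.cofinite_eq_atTop, Filter.eventually_cofinite] at h
    refine (h.image V).subset ?_
    rintro _ ⟨⟨n, rfl⟩, hn⟩
    exact ⟨n, hn, rfl⟩

/-- The Gerlits–Nagy theorem: `S₁(Ω, Γ)` is equivalent to the γ-property. -/
theorem s1OmegaGamma_iff_gammaSpace (X : Type*) [TopologicalSpace X] :
    S1OmegaGamma X ↔ GammaSpace X := by
  constructor
  · intro h U hU
    obtain ⟨V, hV, hg⟩ := h (fun _ => U) (fun _ => hU)
    refine ⟨Set.range V, ?_, Set.countable_range V, hg⟩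
    rintro _ ⟨n, rfl⟩
    exact hV n
  · intro h U hU
    obtain ⟨V₀, hV₀, -, hg₀⟩ := h (U 0) (hU 0)
    obtain ⟨W, hWV, hW⟩ := gamma_enum hg₀
    have hWp : ∀ n, ∃ x, x ∉ W n := fun n => (Set.ne_univ_iff_exists_notMem _).1
      fun he => (hU 0).2.2.1 (he ▸ hV₀ (hWV n))
    have hWo : ∀ n, IsOpen (W n) := fun n => (hU 0).1 _ (hV₀ (hWV n))
    choose p hp using hWp
    let C : Set (Set X) := {v | IsOpen v ∧ ∃ n, v ⊆ W n ∧ ∀ k ≤ n, ∃ w ∈ U k, v ⊆ w}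
    have hCF : ∀ F : Set X, F.Finite → ∃ u ∈ C, F ⊆ u := by
      intro F hF
      have hev : ∀ᶠ n in Filter.atTop, ∀ x ∈ F, x ∈ W n :=
        (Filter.eventually_all_finite hF).2 fun x _ => hW x
      obtain ⟨n, hn⟩ := hev.exists
      choose w hw hFw using fun k => (hU k).2.2.2 F hF
      refine ⟨W n ∩ ⋂ k ∈ Set.Iic n, w k, ⟨?_, n, Set.inter_subset_left, ?_⟩, ?_⟩
      · exact (hWo n).inter ((Set.finite_Iic n).isOpen_biInter fun k _ => (hU k).1 _ (hw k))
      · intro k hk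
        exact ⟨w k, hw k, Set.inter_subset_right.trans (Set.biInter_subset_of_mem hk)⟩
      · exact Set.subset_inter hn (Set.subset_iInter₂ fun k _ => hFw k)
    have hC : IsOmegaCover C := by
      refine ⟨fun u hu => hu.1, ?_, ?_, hCF⟩
      · refine Set.eq_univ_of_forall fun x => ?_
        obtain ⟨u, hu, hxu⟩ := hCF {x} (Set.finite_singleton x)
        exact ⟨u, hu, hxu rfl⟩
      · rintro ⟨-, n, hn, -⟩
        exact hp n (hn trivial)
    obtain ⟨V, hVC, -, hg⟩ := h C hC
    obtain ⟨e, heV, he⟩ := gamma_enum hg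
    have key : ∀ N, ∃ j, N ≤ j ∧ ∃ w ∈ U N, e j ⊆ w := by
      intro N
      have hev : ∀ᶠ j in Filter.atTop, ∀ k ∈ Set.Iio N, p k ∈ e j :=
        (Filter.eventually_all_finite (Set.finite_Iio N)).2 fun k _ => he (p k)
      obtain ⟨j, hj, hNj⟩ := (hev.and (Filter.eventually_ge_atTop N)).exists
      obtain ⟨-, n, hn, hk⟩ := hVC (heV j)
      refine ⟨j, hNj, hk N ?_⟩
      by_contra hlt
      exact hp n (hn (hj n (not_le.1 hlt)))
    choose j hj w hw hjw using key
    refine ⟨w, hw, gamma_of_seq w (fun n => (hU n).1 _ (hw n))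
      (fun n hn => (hU n).2.2.1 (hn ▸ hw n)) fun x => ?_⟩
    have ht : Filter.Tendsto j Filter.atTop Filter.atTop :=
      Filter.tendsto_atTop_mono hj Filter.tendsto_id
    filter_upwards [ht.eventually (he x)] with n hn
    exact hjw n hn
end

section
/- If (X_n) is an increasing sequence of sets of reals (X_n ⊆ X_{n+1} for all n) such that each X_n, with the subspace topology, has the δ-property, then X = ⋃_n X_n has the δ-property. -/
/-- `LClosure F` is the closure of the family `F` of subsets of `X` under the
operation `(Aₙ) ↦ liminf Aₙ = ⋃ₘ ⋂_{n ≥ m} Aₙ` applied to sequences from the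
family. -/
inductive LClosure {X : Type*} (F : Set (Set X)) : Set X → Prop
  | base (A : Set X) (hA : A ∈ F) : LClosure F A
  | liminf (A : ℕ → Set X) (hA : ∀ n, LClosure F (A n)) :
      LClosure F (⋃ m, ⋂ n, ⋂ (_ : m ≤ n), A n)

/-- The δ-property of Gerlits and Nagy: for every open ω-cover `U` of the
space, the whole space belongs to `L(U)`. -/
def DeltaProp (X : Type*) [TopologicalSpace X] : Prop :=
  ∀ U : Set (Set X), IsOmegaCover U → LClosure U Set.univ

theorem LClosure.lift_preimage {X Y : Type*} (f : Y → X) (U : Set (Set X)) (A : Set Y)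
    (h : LClosure (Set.image (Set.preimage f) U) A) : ∃ B, LClosure U B ∧ Set.preimage f B = A := by
  induction h with
  | base A hA =>
    obtain ⟨u, hu, rfl⟩ := hA
    exact ⟨u, LClosure.base u hu, rfl⟩
  | liminf A hA ih =>
    choose B hB hBA using ih
    refine ⟨_, LClosure.liminf B hB, ?_⟩
    simp only [Set.preimage_iUnion, Set.preimage_iInter, hBA]

/-- An increasing countable union of sets of reals with the δ-property has
the δ-property. -/
theorem iUnion_deltaProp_of_monotone (X : ℕ → Set ℝ)
    (hmono : ∀ n, X n ⊆ X (n + 1))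
    (hδ : ∀ n, DeltaProp ↥(X n)) :
    DeltaProp ↥(⋃ n, X n) := by
  intro U hU
  obtain ⟨hop, hcov, -, hfin⟩ := hU
  have key : ∀ n, ∃ B, LClosure U B ∧
      Set.preimage (Set.inclusion (Set.subset_iUnion X n)) (B) = Set.univ := by
    intro n
    apply LClosure.lift_preimage
    by_cases h : Set.univ ∈ Set.image (Set.preimage (Set.inclusion (Set.subset_iUnion X n))) U
    · exact LClosure.base _ h
    · refine hδ n _ ⟨?_, ?_, h, ?_⟩
      · rintro _ ⟨u, hu, rfl⟩
        exact (hop u hu).preimage (continuous_inclusion _)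
      · refine Set.eq_univ_of_forall fun x => ?_
        have hx : Set.inclusion (Set.subset_iUnion X n) x ∈ ⋃₀ U := hcov ▸ Set.mem_univ _
        obtain ⟨u, hu, hxu⟩ := hx
        exact ⟨_, ⟨u, hu, rfl⟩, hxu⟩
      · intro F hF
        obtain ⟨u, hu, hs⟩ := hfin _ (hF.image (Set.inclusion (Set.subset_iUnion X n)))
        exact ⟨_, ⟨u, hu, rfl⟩, Set.image_subset_iff.1 hs⟩
  choose B hB hBX using key
  have hm : Monotone X := monotone_nat_of_le_succ hmono
  have heq : (⋃ m, ⋂ n, ⋂ (_ : m ≤ n), B n) = Set.univ := by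
    refine Set.eq_univ_of_forall fun x => ?_
    obtain ⟨m, hxm⟩ := Set.mem_iUnion.1 x.2
    refine Set.mem_iUnion.2 ⟨m, Set.mem_iInter₂.2 fun n hn => ?_⟩
    have : (⟨x.1, hm hn hxm⟩ : X n) ∈ Set.preimage (Set.inclusion (Set.subset_iUnion X n)) (B n) :=
      hBX n ▸ Set.mem_univ _
    exact this
  exact heq ▸ LClosure.liminf B hB
end
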